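/- arXiv:2303.11872 — 5 statements merged into one kernel-verified Lean document; each statement's English description precedes it below -/
import Mathlib

section
/- Let k ≥ 1 be an integer with k ≢ 3 (mod 9) such that D is squarefree, and let p be a prime such that S_k(x) is irreducible in 𝔽_p[x]. Then p is a k-Shanks prime if and only if the polynomial S_k(x^p) is non-monogenic. -/
open Polynomial IntermediateField

/-- The sequence `U₀ = U₁ = 0`, `U₂ = 1`,
`U_n = k·U_{n−1} + (k+3)·U_{n−2} + U_{n−3}` for `n ≥ 3`. -/
def shanksSeq (k : ℤ) : ℕ → ℤ
  | 0 => 0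
  | 1 => 0
  | 2 => 1
  | n + 3 => k * shanksSeq k (n + 2) + (k + 3) * shanksSeq k (n + 1) + shanksSeq k n

/-- `π(m)`: the least period of the sequence `(U_n)` modulo `m`. -/
noncomputable def shanksPeriod (k : ℤ) (m : ℕ) : ℕ :=
  sInf {n : ℕ | 0 < n ∧ ∀ j : ℕ, (shanksSeq k (j + n) : ZMod m) = (shanksSeq k j : ZMod m)}

/-- A prime `p` is a `k`-Shanks prime if `π(p²) = π(p)`. -/
def IsShanksPrime (k : ℤ) (p : ℕ) : Prop :=
  p.Prime ∧ shanksPeriod k (p ^ 2) = shanksPeriod k p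

/-- The Shanks polynomial `x³ − k·x² − (k+3)·x − 1`. -/
noncomputable def shanksPoly (k : ℤ) : ℤ[X] :=
  X ^ 3 - C k * X ^ 2 - C (k + 3) * X - 1

theorem shanksPoly_natDegree (k : ℤ) : (shanksPoly k).natDegree = 3 := by
  unfold shanksPoly
  compute_degree!

theorem shanksPoly_monic (k : ℤ) : (shanksPoly k).Monic := by
  unfold shanksPoly
  monicity!

theorem aeval_shanksPoly {A : Type*} [CommRing A] (k : ℤ) (x : A) :
    aeval x (shanksPoly k) = x ^ 3 - (k : A) * x ^ 2 - ((k : A) + 3) * x - 1 := by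
  simp [shanksPoly, map_ofNat]

theorem shanksPoly_map {A : Type*} [CommRing A] (k : ℤ) (f : ℤ →+* A) :
    (shanksPoly k).map f = X ^ 3 - C (k : A) * X ^ 2 - C ((k : A) + 3) * X - 1 := by
  simp [shanksPoly, map_ofNat]

theorem exists_shanksPoly_roots {k : ℤ} (hk : 1 ≤ k) :
    ∃ r : Fin 3 → ℝ, Function.Injective r ∧ r 1 < 0 ∧ ∀ i, aeval (r i) (shanksPoly k) = 0 := by
  have hk' : (1 : ℝ) ≤ k := by exact_mod_cast hk
  have hc : Continuous fun x : ℝ => x ^ 3 - (k : ℝ) * x ^ 2 - ((k : ℝ) + 3) * x - 1 := by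
    fun_prop
  obtain ⟨a, ha, ha0⟩ := intermediate_value_Ioo (a := (-2 : ℝ)) (b := -1) (by norm_num)
    hc.continuousOn (show (0 : ℝ) ∈ _ from ⟨by norm_num; linarith, by linarith⟩)
  obtain ⟨b, hb, hb0⟩ := intermediate_value_Ioo' (a := (-1 : ℝ)) (b := 0) (by norm_num)
    hc.continuousOn (show (0 : ℝ) ∈ _ from ⟨by norm_num, by linarith⟩)
  obtain ⟨c, hc, hc0⟩ := intermediate_value_Ioo (a := (0 : ℝ)) (b := k + 3) (by linarith)
    hc.continuousOn (show (0 : ℝ) ∈ _ from ⟨by norm_num, by nlinarith⟩)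
  simp only [Set.mem_Ioo] at ha hb hc
  have hmono : StrictMono ![a, b, c] := by
    rw [Fin.strictMono_iff_lt_succ]
    intro i
    fin_cases i <;> simp <;> linarith
  refine ⟨![a, b, c], hmono.injective, by simp; linarith, fun i => ?_⟩
  rw [aeval_shanksPoly]
  fin_cases i <;> assumption

theorem sq_one_add_mul_pow_lt {g : ℝ} (hg : g ^ 2 ≠ 1) {t : ℕ} (ht : t ≠ 0) :
    (1 + g) ^ 2 * (g ^ 2) ^ t < (1 + g ^ (2 * t + 1)) ^ 2 := by
  have key : (1 + g ^ (2 * t + 1)) ^ 2 - (1 + g) ^ 2 * (g ^ 2) ^ t =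
      (1 - (g ^ 2) ^ t) * (1 - (g ^ 2) ^ (t + 1)) := by
    simp only [← pow_mul]
    ring
  have hnn : 0 ≤ g ^ 2 := sq_nonneg g
  rw [← sub_pos, key]
  rcases lt_or_gt_of_ne hg with h | h
  · exact mul_pos (sub_pos.2 (pow_lt_one₀ hnn h ht)) (sub_pos.2 (pow_lt_one₀ hnn h t.succ_ne_zero))
  · exact mul_pos_of_neg_of_neg (sub_neg.2 (one_lt_pow₀ h ht))
      (sub_neg.2 (one_lt_pow₀ h t.succ_ne_zero))

/-- A monic polynomial of degree `n` over a field with `n` distinct roots splits into the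
corresponding linear factors. -/
theorem eq_prod_X_sub_C_of_injective {F : Type*} [Field F] {n : ℕ} {m : F[X]} (hm : m.Monic)
    (hn : m.natDegree = n) {g : Fin n → F} (hg : Function.Injective g) (h : ∀ i, m.IsRoot (g i)) :
    m = ∏ i, (X - C (g i)) := by
  refine eq_of_monic_of_dvd_of_natDegree_le (monic_prod_of_monic _ _ fun i _ => monic_X_sub_C _)
    hm ?_ ?_
  · exact Finset.prod_dvd_of_coprime
      (fun i _ j _ hij => pairwise_coprime_X_sub_C hg hij) fun i _ => dvd_iff_isRoot.2 (h i)
  · rw [natDegree_prod_of_monic _ _ fun i _ => monic_X_sub_C _]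
    simp [hn]

theorem pow_ne_shanksPoly_root {k : ℤ} (hk : 1 ≤ k) {K : Type*} [Field K] [Algebra ℚ K]
    (pb : PowerBasis ℚ K) (hpb : minpoly ℚ pb.gen = (shanksPoly k).map (Int.castRingHom ℚ))
    {p : ℕ} (hp : p.Prime) (γ : K) : γ ^ p ≠ pb.gen := by
  intro hγ
  obtain ⟨r, hrinj, hr1, hr⟩ := exists_shanksPoly_roots hk
  have hr' : ∀ i, aeval (r i) (minpoly ℚ pb.gen) = 0 := fun i => by
    rw [hpb, ← algebraMap_int_eq, aeval_map_algebraMap]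
    exact hr i
  set τ : Fin 3 → (K →ₐ[ℚ] ℝ) := fun i => pb.lift (r i) (hr' i) with hτ
  set g : Fin 3 → ℝ := fun i => τ i γ with hgdef
  have hgr : ∀ i, g i ^ p = r i := fun i => by
    simp only [hgdef, hτ]
    rw [← map_pow, hγ, PowerBasis.lift_gen]
  have hginj : Function.Injective g := fun i j hij => hrinj (by rw [← hgr, ← hgr, hij])
  rcases hp.eq_two_or_odd' with rfl | ⟨t, rfl⟩
  · exact absurd (hgr 1 ▸ sq_nonneg (g 1)) (not_le.2 hr1)
  have ht : t ≠ 0 := by rintro rfl; exact Nat.not_prime_one hp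
  have hSint : IsIntegral ℤ pb.gen := by
    refine ⟨shanksPoly k, shanksPoly_monic k, ?_⟩
    have := minpoly.aeval ℚ pb.gen
    rwa [hpb, ← algebraMap_int_eq, aeval_map_algebraMap] at this
  have hγint : IsIntegral ℤ γ := IsIntegral.of_pow hp.pos (hγ ▸ hSint)
  have hfin : Module.finrank ℚ K = 3 := by
    rw [pb.finrank, ← pb.natDegree_minpoly, hpb, (shanksPoly_monic k).natDegree_map,
      shanksPoly_natDegree]
  have : FiniteDimensional ℚ K := pb.finite
  have htop : ℚ⟮γ⟯ = ⊤ := by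
    rw [← IntermediateField.toSubalgebra_inj, IntermediateField.top_toSubalgebra, eq_top_iff,
      ← pb.adjoin_gen_eq_top, Algebra.adjoin_le_iff, Set.singleton_subset_iff, ← hγ]
    exact pow_mem (mem_adjoin_simple_self ℚ γ) _
  have hdeg : (minpoly ℤ γ).natDegree = 3 := by
    have := (Field.primitive_element_iff_minpoly_natDegree_eq ℚ γ).1 htop
    rwa [minpoly.isIntegrallyClosed_eq_field_fractions' ℚ hγint,
      (minpoly.monic hγint).natDegree_map, hfin] at this
  have hm := eq_prod_X_sub_C_of_injective ((minpoly.monic hγint).map (algebraMap ℤ ℝ))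
    (by rw [(minpoly.monic hγint).natDegree_map, hdeg]) hginj fun i => by
      rw [IsRoot, eval_map_algebraMap]
      exact (aeval_algHom_apply ((τ i).restrictScalars ℤ) γ _).trans (by simp)
  have hS := eq_prod_X_sub_C_of_injective ((shanksPoly_monic k).map (algebraMap ℤ ℝ))
    (by rw [(shanksPoly_monic k).natDegree_map, shanksPoly_natDegree]) hrinj fun i => by
      rw [IsRoot, eval_map_algebraMap]
      exact hr i
  have hm1 : (((minpoly ℤ γ).eval (-1) : ℤ) : ℝ) = - ((1 + g 0) * (1 + g 1) * (1 + g 2)) := by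
    have := congrArg (eval (-1)) hm
    rw [Fin.prod_univ_three, eval_map_algebraMap] at this
    have h2 : aeval (-1 : ℝ) (minpoly ℤ γ) = (((minpoly ℤ γ).eval (-1) : ℤ) : ℝ) := by
      have := aeval_algebraMap_apply ℝ (-1 : ℤ) (minpoly ℤ γ)
      simpa using this
    rw [← h2, this]
    simp
    ring
  have hS1 : (1 + r 0) * (1 + r 1) * (1 + r 2) = -1 := by
    have := congrArg (eval (-1)) hS
    rw [Fin.prod_univ_three, eval_map_algebraMap, aeval_shanksPoly] at this
    simp at this
    linarith
  have hS0 : r 0 * r 1 * r 2 = 1 := by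
    have := congrArg (eval 0) hS
    rw [Fin.prod_univ_three, eval_map_algebraMap, aeval_shanksPoly] at this
    simp at this
    linarith
  have hg0 : g 0 * g 1 * g 2 = 1 := by
    have : (g 0 * g 1 * g 2) ^ (2 * t + 1) = 1 := by
      rw [mul_pow, mul_pow, hgr, hgr, hgr, hS0]
    exact (Odd.strictMono_pow ⟨t, rfl⟩).injective (this.trans (one_pow (2 * t + 1)).symm)
  have hgne : ∀ i, g i ^ 2 ≠ 1 := fun i hi => by
    have h1 := hr i
    have hk' : (1 : ℝ) ≤ k := by exact_mod_cast hk
    rw [aeval_shanksPoly, ← hgr i] at h1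
    rcases sq_eq_one_iff.1 hi with h | h
    · rw [h, one_pow] at h1
      linarith
    · rw [h, Odd.neg_one_pow ⟨t, rfl⟩] at h1
      linarith
  have hlt := fun i => sq_one_add_mul_pow_lt (hgne i) ht
  have hprod : ((1 + g 0) ^ 2 * (g 0 ^ 2) ^ t) * ((1 + g 1) ^ 2 * (g 1 ^ 2) ^ t) *
      ((1 + g 2) ^ 2 * (g 2 ^ 2) ^ t) < 1 := by
    calc _ < (1 + g 0 ^ (2 * t + 1)) ^ 2 * (1 + g 1 ^ (2 * t + 1)) ^ 2 *
        (1 + g 2 ^ (2 * t + 1)) ^ 2 := by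
          gcongr <;> apply hlt
      _ = ((1 + r 0) * (1 + r 1) * (1 + r 2)) ^ 2 := by rw [hgr, hgr, hgr]; ring
      _ = 1 := by rw [hS1]; norm_num
  have hlt1 : (((minpoly ℤ γ).eval (-1) : ℤ) : ℝ) ^ 2 < 1 := by
    calc _ = ((1 + g 0) * (1 + g 1) * (1 + g 2)) ^ 2 * ((g 0 * g 1 * g 2) ^ 2) ^ t := by
          rw [hm1, hg0]; simp
      _ < 1 := by
        refine lt_of_eq_of_lt ?_ hprod
        simp only [mul_pow]
        ring
  have hz : (minpoly ℤ γ).eval (-1) = 0 := by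
    have : ((minpoly ℤ γ).eval (-1)) ^ 2 < 1 := by exact_mod_cast hlt1
    nlinarith [sq_nonneg ((minpoly ℤ γ).eval (-1))]
  rw [hz, eq_comm, Int.cast_zero, neg_eq_zero, mul_eq_zero, mul_eq_zero] at hm1
  rcases hm1 with (h | h) | h
  all_goals exact hgne _ (by rw [← neg_eq_of_add_eq_zero_right h]; norm_num)

theorem minpoly_int_eq_of_irreducible {A : Type*} [CommRing A] [IsDomain A] [CharZero A]
    {x : A} {f : ℤ[X]} (hf : f.Monic) (hirr : Irreducible f) (h0 : aeval x f = 0) :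
    minpoly ℤ x = f := by
  have hx : IsIntegral ℤ x := ⟨f, hf, h0⟩
  refine eq_of_monic_of_associated (minpoly.monic hx) hf ?_
  exact ((minpoly.irreducible hx).dvd_irreducible_iff_associated hirr).1
    (minpoly.isIntegrallyClosed_dvd hx h0)

theorem cubic_isEisensteinAt {q a b c : ℤ} (hq : Prime q) (ha : q ∣ a) (hb : q ∣ b) (hc : q ∣ c)
    (hc2 : ¬ q ^ 2 ∣ c) :
    (X ^ 3 + C a * X ^ 2 + C b * X + C c : ℤ[X]).IsEisensteinAt (Ideal.span {q}) := by
  have hdeg : (X ^ 3 + C a * X ^ 2 + C b * X + C c : ℤ[X]).natDegree = 3 := by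
    compute_degree!
  have hmonic : (X ^ 3 + C a * X ^ 2 + C b * X + C c : ℤ[X]).Monic := by monicity!
  refine ⟨?_, fun {n} hn => ?_, ?_⟩
  · rw [hmonic.leadingCoeff, Ideal.mem_span_singleton]
    exact hq.not_dvd_one
  · rw [hdeg] at hn
    rw [Ideal.mem_span_singleton]
    simp only [coeff_add, coeff_X_pow, coeff_C_mul, coeff_X, coeff_C]
    interval_cases n <;> simpa
  · rw [Ideal.span_singleton_pow, Ideal.mem_span_singleton]
    simpa using hc2

theorem mem_adjoin_of_prime_smul_of_isEisensteinAt {K : Type*} [Field K] [Algebra ℚ K] {y : K}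
    (hy : Algebra.adjoin ℚ {y} = ⊤) {f : ℤ[X]} (hf : f.Monic) (hf0 : f.natDegree ≠ 0) {q : ℤ}
    (hq : Prime q)
    (hE : f.IsEisensteinAt (Ideal.span {q})) (h0 : aeval y f = 0) {z : K} (hz : IsIntegral ℤ z)
    (hqz : q • z ∈ Algebra.adjoin ℤ {y}) : z ∈ Algebra.adjoin ℤ {y} := by
  have : CharZero K := algebraRat.charZero K
  have hyint : IsIntegral ℤ y := ⟨f, hf, h0⟩
  have hirr : Irreducible f := hE.irreducible
    ((Ideal.span_singleton_prime hq.ne_zero).2 hq) hf.isPrimitive (Nat.pos_of_ne_zero hf0)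
  let B := PowerBasis.ofAdjoinEqTop (hyint.tower_top (A := ℚ)) hy
  have hB : B.gen = y := PowerBasis.ofAdjoinEqTop_gen _ _
  have := mem_adjoin_of_smul_prime_smul_of_minpoly_isEisensteinAt (B := B) hq
    (by rwa [hB]) hz (by rwa [hB]) (by
      rwa [hB, minpoly_int_eq_of_irreducible hf hirr h0])
  rwa [hB] at this

theorem mem_of_smul_mem_of_primes {M : Type*} [AddCommGroup M] (A : Submodule ℤ M)
    (P : M → Prop) (hP : ∀ (n : ℕ) z, P z → P (n • z)) {n : ℕ} (hn : n ≠ 0)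
    (h : ∀ q : ℕ, q.Prime → q ∣ n → ∀ z, P z → q • z ∈ A → z ∈ A) {z : M} (hz : P z)
    (hnz : n • z ∈ A) : z ∈ A := by
  induction n using induction_on_primes generalizing z with
  | zero => exact absurd rfl hn
  | one => simpa using hnz
  | prime_mul q a hq ih =>
    have ha : a ≠ 0 := right_ne_zero_of_mul hn
    refine ih ha (fun q' hq' hd => h q' hq' (hd.mul_left _)) hz ?_
    exact h q hq (dvd_mul_right _ _) _ (hP a z hz) (by rwa [smul_smul])

theorem not_sq_dvd_disc {k : ℤ}
    (hD : Squarefree (if (3 : ℤ) ∣ k then (k / 3) ^ 2 + k / 3 + 1 else k ^ 2 + 3 * k + 9))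
    {q : ℤ} (hq : Prime q) (hq3 : ¬ q ∣ 3) : ¬ q ^ 2 ∣ k ^ 2 + 3 * k + 9 := by
  intro h
  refine hq.not_isUnit ?_
  split_ifs at hD with h3
  · obtain ⟨m, rfl⟩ := h3
    rw [Int.mul_ediv_cancel_left _ (by norm_num)] at hD
    refine hD q ?_
    have h9 : IsCoprime (q ^ 2) (3 ^ 2) :=
      ((Prime.coprime_iff_not_dvd hq).2 hq3).pow
    rw [← sq]
    refine h9.dvd_of_dvd_mul_left (h.trans (dvd_of_eq ?_))
    ring
  · exact hD q (by rwa [← sq])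

theorem exists_eq_of_mem_adjoin_shanksPoly_root {k : ℤ} {A : Type*} [CommRing A] {x : A}
    (h0 : aeval x (shanksPoly k) = 0) {w : A} (hw : w ∈ Algebra.adjoin ℤ {x}) :
    ∃ a b c : ℤ, w = a + b * x + c * x ^ 2 := by
  rw [Algebra.adjoin_singleton_eq_range_aeval] at hw
  obtain ⟨f, rfl⟩ := hw
  have hdeg : (f %ₘ shanksPoly k).natDegree < 3 := by
    have := natDegree_modByMonic_lt f (shanksPoly_monic k) (fun h => by
      simpa [shanksPoly_natDegree] using congrArg natDegree h)
    rwa [shanksPoly_natDegree] at this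
  refine ⟨(f %ₘ shanksPoly k).coeff 0, (f %ₘ shanksPoly k).coeff 1,
    (f %ₘ shanksPoly k).coeff 2, ?_⟩
  change aeval x f = _
  rw [← aeval_modByMonic_eq_self_of_root h0, aeval_eq_sum_range' hdeg]
  simp [Finset.sum_range_succ]

theorem mem_adjoin_gen_of_prime_smul {k : ℤ} (hk9 : ¬ k ≡ 3 [ZMOD 9])
    (hD : Squarefree (if (3 : ℤ) ∣ k then (k / 3) ^ 2 + k / 3 + 1 else k ^ 2 + 3 * k + 9))
    {K : Type*} [Field K] [Algebra ℚ K] {x : K} (hx : Algebra.adjoin ℚ {x} = ⊤)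
    (h0 : aeval x (shanksPoly k) = 0) {q : ℤ} (hq : Prime q) (hqd : q ∣ k ^ 2 + 3 * k + 9)
    {z : K} (hz : IsIntegral ℤ z) (hqz : q • z ∈ Algebra.adjoin ℤ {x}) :
    z ∈ Algebra.adjoin ℤ {x} := by
  have h0' := h0
  rw [aeval_shanksPoly] at h0
  have hxmem : x ∈ Algebra.adjoin ℤ {x} := Algebra.self_mem_adjoin_singleton ℤ x
  by_cases hq3 : q ∣ 3
  · have h3q : (3 : ℤ) ∣ q := ((hq.dvd_prime_iff_associated Int.prime_three).1 hq3).symm.dvd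
    have h3k : (3 : ℤ) ∣ k := by
      refine Int.prime_three.dvd_of_dvd_pow (n := 2) ?_
      have := h3q.trans hqd
      omega
    have hadj : ∀ (R : Type) [CommRing R] [Algebra R K],
        Algebra.adjoin R {x - 1} = Algebra.adjoin R {x} := fun R _ _ => by
      refine le_antisymm (Algebra.adjoin_singleton_le ?_) (Algebra.adjoin_singleton_le ?_)
      · exact sub_mem (Algebra.self_mem_adjoin_singleton R x) (one_mem _)
      · have := add_mem (Algebra.self_mem_adjoin_singleton R (x - 1)) (one_mem _)
        rwa [sub_add_cancel] at this
    rw [← hadj ℤ] at hqz ⊢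
    refine mem_adjoin_of_prime_smul_of_isEisensteinAt ((hadj ℚ).trans hx)
      (f := X ^ 3 + C (3 - k) * X ^ 2 + C (-3 * k) * X + C (-(2 * k + 3)))
      (by monicity!) (by rw [show natDegree _ = 3 by compute_degree!]; norm_num)
      hq (cubic_isEisensteinAt hq ?_ ?_ ?_ ?_) ?_ hz hqz
    · exact hq3.trans (by omega)
    · exact hq3.trans (by omega)
    · exact hq3.trans (by omega)
    · intro h
      have h9 : (3 : ℤ) ^ 2 ∣ -(2 * k + 3) := (pow_dvd_pow_of_dvd h3q 2).trans h
      refine hk9 ?_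
      rw [Int.ModEq]
      omega
    · simp [map_ofNat]
      linear_combination h0
  · have hq9 : IsCoprime q ((3 : ℤ) ^ 2) := ((Prime.coprime_iff_not_dvd hq).2 hq3).pow_right
    have hle : Algebra.adjoin ℤ {3 * x - (k : K)} ≤ Algebra.adjoin ℤ {x} :=
      Algebra.adjoin_singleton_le
        (sub_mem (mul_mem (ofNat_mem _ 3) hxmem) (intCast_mem _ k))
    have htop : Algebra.adjoin ℚ {3 * x - (k : K)} = ⊤ := by
      rw [eq_top_iff, ← hx]
      refine Algebra.adjoin_singleton_le ?_
      have : x = (1 / 3 : ℚ) • (3 * x - (k : K)) + algebraMap ℚ K (k / 3) := by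
        have : CharZero K := algebraRat.charZero K
        rw [Algebra.smul_def]
        simp
        ring
      have hmem := add_mem
        (Subalgebra.smul_mem _ (Algebra.self_mem_adjoin_singleton ℚ (3 * x - (k : K))) (1 / 3 : ℚ))
        (Subalgebra.algebraMap_mem (Algebra.adjoin ℚ {3 * x - (k : K)}) ((k : ℚ) / 3))
      rwa [← this] at hmem
    have h9 : ∀ w ∈ Algebra.adjoin ℤ {x}, (9 : ℤ) • w ∈ Algebra.adjoin ℤ {3 * x - (k : K)} := by
      intro w hw
      have h3x : 3 * x ∈ Algebra.adjoin ℤ {3 * x - (k : K)} := by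
        have := add_mem (Algebra.self_mem_adjoin_singleton ℤ (3 * x - (k : K))) (intCast_mem _ k)
        rwa [sub_add_cancel] at this
      obtain ⟨a, b, c, rfl⟩ := exists_eq_of_mem_adjoin_shanksPoly_root h0' hw
      have : (9 : ℤ) • ((a : K) + b * x + c * x ^ 2) =
          9 * (a : K) + 3 * b * (3 * x) + c * (3 * x) ^ 2 := by
        rw [zsmul_eq_mul]
        push_cast
        ring
      rw [this]
      exact add_mem (add_mem (mul_mem (ofNat_mem _ 9) (intCast_mem _ a))
        (mul_mem (mul_mem (ofNat_mem _ 3) (intCast_mem _ b)) h3x))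
        (mul_mem (intCast_mem _ c) (pow_mem h3x 2))
    have h9z : (9 : ℤ) • z ∈ Algebra.adjoin ℤ {x} := by
      refine hle (mem_adjoin_of_prime_smul_of_isEisensteinAt htop
        (f := X ^ 3 + C 0 * X ^ 2 + C (-3 * (k ^ 2 + 3 * k + 9)) * X +
          C (-((2 * k + 3) * (k ^ 2 + 3 * k + 9))))
        (by monicity!) (by rw [show natDegree _ = 3 by compute_degree!]; norm_num)
        hq (cubic_isEisensteinAt hq (dvd_zero _) (hqd.mul_left _) ?_ ?_) ?_
        (hz.smul 9) ?_)
      · exact (hqd.mul_left _).neg_right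
      · rw [dvd_neg]
        intro h
        refine not_sq_dvd_disc hD hq hq3 ((IsCoprime.pow_left ?_).dvd_of_dvd_mul_left h)
        refine (Prime.coprime_iff_not_dvd hq).2 fun hd => hq3 (hq.dvd_of_dvd_pow (n := 3) ?_)
        have : (3 : ℤ) ^ 3 = 4 * (k ^ 2 + 3 * k + 9) - (2 * k + 3) * (2 * k + 3) := by ring
        rw [this]
        exact dvd_sub (hqd.mul_left _) (hd.mul_left _)
      · simp [map_ofNat]
        linear_combination 27 * h0
      · rw [smul_comm]
        exact h9 _ hqz
    obtain ⟨a, b, hab⟩ := hq9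
    have : z = a • (q • z) + b • ((9 : ℤ) • z) := by
      rw [smul_smul, smul_smul, ← add_smul, show a * q + b * 9 = 1 by linarith, one_smul]
    rw [this]
    exact add_mem (Subalgebra.smul_mem _ hqz a) (Subalgebra.smul_mem _ h9z b)

theorem mem_adjoin_gen_of_isIntegral {k : ℤ} (hk9 : ¬ k ≡ 3 [ZMOD 9])
    (hD : Squarefree (if (3 : ℤ) ∣ k then (k / 3) ^ 2 + k / 3 + 1 else k ^ 2 + 3 * k + 9))
    {K : Type*} [Field K] [Algebra ℚ K]
    (pb : PowerBasis ℚ K) (hpb : minpoly ℚ pb.gen = (shanksPoly k).map (Int.castRingHom ℚ))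
    {z : K} (hz : IsIntegral ℤ z) : z ∈ Algebra.adjoin ℤ {pb.gen} := by
  have : CharZero K := algebraRat.charZero K
  have : FiniteDimensional ℚ K := pb.finite
  have h0 : aeval pb.gen (shanksPoly k) = 0 := by
    have := minpoly.aeval ℚ pb.gen
    rwa [hpb, ← algebraMap_int_eq, aeval_map_algebraMap] at this
  have hinteg : IsIntegral ℤ pb.gen := ⟨_, shanksPoly_monic k, h0⟩
  have hΔ : k ^ 2 + 3 * k + 9 ≠ 0 := by nlinarith [sq_nonneg (2 * k + 3)]
  set s : K := aeval pb.gen (derivative (shanksPoly k)) with hs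
  have hsint : IsIntegral ℤ s :=
    adjoin_le_integralClosure hinteg (aeval_mem_adjoin_singleton ℤ _)
  have hdiscr := Algebra.discr_mul_isIntegral_mem_adjoin (K := ℚ) (B := pb) hinteg hz
  rw [Algebra.discr_powerBasis_eq_norm, hpb, derivative_map, ← algebraMap_int_eq,
    aeval_map_algebraMap, ← hs] at hdiscr
  obtain ⟨d, hd⟩ := IsIntegrallyClosed.isIntegral_iff.1 (Algebra.isIntegral_norm ℚ hsint)
  obtain ⟨w, hw, hsw⟩ : ∃ w : K, IsIntegral ℤ w ∧ s * w = (k ^ 2 + 3 * k + 9 : ℤ) := by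
    refine ⟨aeval pb.gen (2 * X ^ 2 - C (2 * k + 1) * X - C (k + 4)),
      adjoin_le_integralClosure hinteg (aeval_mem_adjoin_singleton ℤ _), ?_⟩
    rw [aeval_shanksPoly] at h0
    simp only [hs, shanksPoly]
    simp [map_ofNat]
    linear_combination (6 * pb.gen - 4 * k - 3) * h0
  obtain ⟨e, he⟩ := IsIntegrallyClosed.isIntegral_iff.1 (Algebra.isIntegral_norm ℚ hw)
  have hde : d * e = (k ^ 2 + 3 * k + 9) ^ Module.finrank ℚ K := by
    have := congrArg (Algebra.norm ℚ) hsw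
    rw [map_mul, ← hd, ← he, ← map_intCast (algebraMap ℚ K), Algebra.norm_algebraMap] at this
    simp only [algebraMap_int_eq, eq_intCast] at this
    exact_mod_cast this
  have hd0 : d ≠ 0 := left_ne_zero_of_mul (hde ▸ pow_ne_zero _ hΔ)
  refine mem_of_smul_mem_of_primes (Subalgebra.toSubmodule (Algebra.adjoin ℤ {pb.gen}))
    (IsIntegral ℤ) (fun n z hz => hz.smul n) (Int.natAbs_ne_zero.2 hd0) ?_ hz ?_
  · intro q hq hqd z hz hqz
    have hq' : Prime (q : ℤ) := Nat.prime_iff_prime_int.1 hq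
    refine mem_adjoin_gen_of_prime_smul hk9 hD pb.adjoin_gen_eq_top h0 hq' ?_ hz
      (by simpa using hqz)
    exact hq'.dvd_of_dvd_pow (hde ▸ (Int.natCast_dvd.2 hqd).mul_right e)
  · have hsmul : (d.natAbs : ℤ) • z ∈ Algebra.adjoin ℤ {pb.gen} := by
      rw [← hd, algebraMap_int_eq, eq_intCast] at hdiscr
      have hdz : d • z ∈ Algebra.adjoin ℤ {pb.gen} := by
        rcases neg_one_pow_eq_or ℚ
            (Module.finrank ℚ K * (Module.finrank ℚ K - 1) / 2) with h | h
        · rwa [h, one_mul, Int.cast_smul_eq_zsmul] at hdiscr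
        · rwa [h, neg_one_mul, neg_smul, neg_mem_iff, Int.cast_smul_eq_zsmul] at hdiscr
      rcases Int.natAbs_eq d with h | h
      · rwa [← h]
      · rwa [← neg_mem_iff, ← neg_smul, ← h]
    simpa using hsmul

theorem minpoly_rat_eq_of_irreducible {A : Type*} [Field A] [Algebra ℚ A]
    {x : A} {f : ℤ[X]} (hf : f.Monic) (hirr : Irreducible f) (h0 : aeval x f = 0) :
    minpoly ℚ x = f.map (Int.castRingHom ℚ) := by
  have : CharZero A := algebraRat.charZero A
  have hx : IsIntegral ℤ x := ⟨f, hf, h0⟩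
  rw [minpoly.isIntegrallyClosed_eq_field_fractions' ℚ hx,
    minpoly_int_eq_of_irreducible hf hirr h0, algebraMap_int_eq]

theorem X_pow_sub_C_gen_irreducible {k : ℤ} (hk : 1 ≤ k) {E : Type*} [Field E] [Algebra ℚ E]
    {x : E} (hx : minpoly ℚ x = (shanksPoly k).map (Int.castRingHom ℚ)) {p : ℕ} (hp : p.Prime) :
    Irreducible (X ^ p - C (AdjoinSimple.gen ℚ x)) := by
  have hxint : IsIntegral ℚ x := by
    by_contra h
    rw [minpoly.eq_zero h] at hx
    exact ((shanksPoly_monic k).map _).ne_zero hx.symm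
  refine X_pow_sub_C_irreducible_of_prime hp fun b => ?_
  let : Algebra ℚ ℚ⟮x⟯ := ℚ⟮x⟯.algebra'
  exact pow_ne_shanksPoly_root hk (adjoin.powerBasis hxint)
    (by rwa [adjoin.powerBasis_gen, minpoly_gen]) hp b

theorem expand_shanksPoly_irreducible {k : ℤ} (hk : 1 ≤ k) (hS : Irreducible (shanksPoly k))
    {p : ℕ} (hp : p.Prime) : Irreducible (expand ℤ p (shanksPoly k)) := by
  have hmon := (shanksPoly_monic k)
  have hS' : Irreducible ((shanksPoly k).map (Int.castRingHom ℚ)) :=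
    (hmon.irreducible_iff_irreducible_map_fraction_map (K := ℚ)).1 hS
  refine (hmon.expand hp.pos).irreducible_of_irreducible_map (Int.castRingHom ℚ) _ ?_
  rw [map_expand, expand_eq_comp_X_pow]
  refine irreducible_comp (hmon.map _) (monic_X_pow p) hS' fun E _ _ x hx => ?_
  simpa using X_pow_sub_C_gen_irreducible hk hx hp

theorem exists_prime_pow_smul_mem_adjoin {k : ℤ} (hk : 1 ≤ k) (hk9 : ¬ k ≡ 3 [ZMOD 9])
    (hD : Squarefree (if (3 : ℤ) ∣ k then (k / 3) ^ 2 + k / 3 + 1 else k ^ 2 + 3 * k + 9))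
    (hS : Irreducible (shanksPoly k)) {p : ℕ} (hp : p.Prime)
    {L : Type*} [Field L] [NumberField L] {θ : L} (hθ : aeval (θ ^ p) (shanksPoly k) = 0)
    (hgen : ℚ⟮θ⟯ = ⊤) {z : L} (hz : IsIntegral ℤ z) :
    ∃ n : ℕ, ((p ^ n : ℕ) : L) * z ∈ Algebra.adjoin ℤ {θ} := by
  set K : IntermediateField ℚ L := ℚ⟮θ ^ p⟯ with hK
  have hmin := minpoly_rat_eq_of_irreducible (shanksPoly_monic k) hS hθ
  have hρint : IsIntegral ℚ (θ ^ p) := Algebra.IsIntegral.isIntegral _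
  let : Algebra ℚ K := K.algebra'
  set ρ : K := AdjoinSimple.gen ℚ (θ ^ p) with hρ
  have hρL : algebraMap K L ρ = θ ^ p := AdjoinSimple.algebraMap_gen ℚ _
  have hOK : ∀ a : K, IsIntegral ℤ a → (a : L) ∈ Algebra.adjoin ℤ {θ} := by
    intro a ha
    have hpb : minpoly ℚ (adjoin.powerBasis hρint).gen =
        (shanksPoly k).map (Int.castRingHom ℚ) := by
      rwa [adjoin.powerBasis_gen, minpoly_gen]
    have h1 := mem_adjoin_gen_of_isIntegral hk9 hD (adjoin.powerBasis hρint) hpb ha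
    have h2 : (a : L) ∈ (Algebra.adjoin ℤ {(adjoin.powerBasis hρint).gen}).map
        ((IsScalarTower.toAlgHom ℤ K L)) := ⟨a, h1, rfl⟩
    rw [AlgHom.map_adjoin_singleton] at h2
    refine Algebra.adjoin_singleton_le ?_ h2
    change algebraMap K L (adjoin.powerBasis hρint).gen ∈ _
    rw [adjoin.powerBasis_gen, ← hρ, hρL]
    exact pow_mem (Algebra.self_mem_adjoin_singleton ℤ θ) p
  have hminK : minpoly K θ = X ^ p - C ρ :=
    (minpoly.eq_of_irreducible_of_monic (X_pow_sub_C_gen_irreducible hk hmin hp)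
      (by simp [← hρL]) (monic_X_pow_sub_C _ hp.ne_zero)).symm
  have hθK : IsIntegral K θ := Algebra.IsIntegral.isIntegral _
  have htop : Algebra.adjoin K {θ} = ⊤ := by
    have hQ : Algebra.adjoin ℚ {θ} = ⊤ := by
      rw [← adjoin_simple_toSubalgebra_of_isAlgebraic (Algebra.IsAlgebraic.isAlgebraic (R := ℚ) θ),
        hgen, top_toSubalgebra]
    refine eq_top_iff.2 fun x _ => ?_
    have hx : x ∈ Algebra.adjoin ℚ {θ} := hQ ▸ Algebra.mem_top
    induction hx using Algebra.adjoin_induction with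
    | mem x hx => exact Algebra.subset_adjoin hx
    | algebraMap r => exact Subalgebra.algebraMap_mem _ (algebraMap ℚ K r)
    | add x y _ _ hx hy => exact add_mem (hx trivial) (hy trivial)
    | mul x y _ _ hx hy => exact mul_mem (hx trivial) (hy trivial)
  set B := PowerBasis.ofAdjoinEqTop hθK htop with hB
  have hBgen : B.gen = θ := PowerBasis.ofAdjoinEqTop_gen _ _
  have hθint : IsIntegral ℤ θ := by
    refine IsIntegral.of_pow hp.pos ⟨_, shanksPoly_monic k, hθ⟩
  have hdiscr := Algebra.discr_mul_isIntegral_mem_adjoin (R := NumberField.RingOfIntegers K)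
    (K := K) (B := B) (hBgen ▸ hθint.tower_top) (z := z) hz.tower_top
  rw [Algebra.discr_powerBasis_eq_norm, hBgen, hminK] at hdiscr
  set n := Module.finrank K L
  have hderiv : aeval θ (derivative (X ^ p - C ρ)) = p * θ ^ (p - 1) := by
    simp [derivative_X_pow]
  obtain ⟨u, hu⟩ := IsIntegrallyClosed.isIntegral_iff (R := NumberField.RingOfIntegers K).1
    (Algebra.isIntegral_norm K (hθint.tower_top (A := NumberField.RingOfIntegers K)))
  have hnorm : Algebra.norm K (p * θ ^ (p - 1)) * Algebra.norm K θ = p ^ n * ρ ^ n := by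
    rw [← map_mul, mul_assoc, pow_sub_one_mul hp.ne_zero, ← hρL, ← map_natCast (algebraMap K L),
      ← map_mul, Algebra.norm_algebraMap, mul_pow]
  rw [hderiv] at hdiscr
  have hle : ∀ w ∈ Algebra.adjoin (NumberField.RingOfIntegers K) {θ}, w ∈ Algebra.adjoin ℤ {θ} := by
    intro w hw
    induction hw using Algebra.adjoin_induction with
    | mem x hx => exact Algebra.subset_adjoin hx
    | algebraMap r => exact hOK r r.isIntegral_coe
    | add x y _ _ hx hy => exact add_mem hx hy
    | mul x y _ _ hx hy => exact mul_mem hx hy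
  have h1 := hle _ hdiscr
  have hpos : Algebra.norm K (p * θ ^ (p - 1)) • z ∈ Algebra.adjoin ℤ {θ} := by
    rcases neg_one_pow_eq_or K (n * (n - 1) / 2) with h | h
    · rwa [h, one_mul] at h1
    · rwa [h, neg_one_mul, neg_smul, neg_mem_iff] at h1
  have h2 := mul_mem (hOK u u.isIntegral_coe) hpos
  refine ⟨n, ?_⟩
  have hinv : θ ^ p * ((θ ^ p) ^ 2 - k * θ ^ p - (k + 3)) = 1 := by
    rw [aeval_shanksPoly] at hθ
    linear_combination hθ
  have hu' : (u : K) = Algebra.norm K θ := hu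
  have h3 : ((p ^ n : ℕ) : L) * z = ((θ ^ p) ^ 2 - k * θ ^ p - (k + 3)) ^ n *
      ((u : L) * (Algebra.norm K (p * θ ^ (p - 1)) • z)) := by
    have h5 : (θ ^ p) ^ n * ((θ ^ p) ^ 2 - k * θ ^ p - (k + 3)) ^ n = 1 := by
      rw [← mul_pow, hinv, one_pow]
    rw [← hu'] at hnorm
    generalize Algebra.norm K (p * θ ^ (p - 1)) = m at hnorm ⊢
    have h4 := congrArg (algebraMap K L) hnorm
    rw [map_mul, map_mul, map_pow, map_pow, map_natCast, hρL] at h4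
    rw [Algebra.smul_def]
    push_cast
    change algebraMap K L m * (u : L) = _ at h4
    linear_combination (-z * ((θ ^ p) ^ 2 - k * θ ^ p - (k + 3)) ^ n) * h4 - p ^ n * z * h5
  rw [h3]
  have hθp := pow_mem (Algebra.self_mem_adjoin_singleton ℤ θ) p
  exact mul_mem (pow_mem (sub_mem (sub_mem (pow_mem hθp 2) (mul_mem (intCast_mem _ k) hθp))
    (add_mem (intCast_mem _ k) (ofNat_mem _ 3))) n) h2

theorem map_castRingHom_eq_zero_iff {m : ℕ} {h : ℤ[X]} :
    h.map (Int.castRingHom (ZMod m)) = 0 ↔ ∃ g : ℤ[X], h = (m : ℤ[X]) * g := by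
  have : (m : ℤ[X]) = C (m : ℤ) := by simp
  rw [this]
  change _ ↔ C (m : ℤ) ∣ h
  rw [C_dvd_iff_dvd_coeff, Polynomial.ext_iff]
  simp [ZMod.intCast_zmod_eq_zero_iff_dvd]

theorem exists_eq_mul_add_of_map_dvd {m : ℕ} {S h : ℤ[X]}
    (hd : S.map (Int.castRingHom (ZMod m)) ∣ h.map (Int.castRingHom (ZMod m))) :
    ∃ q g : ℤ[X], h = S * q + (m : ℤ[X]) * g := by
  obtain ⟨q', hq'⟩ := hd
  obtain ⟨q, rfl⟩ := map_surjective (Int.castRingHom (ZMod m)) ZMod.intCast_surjective q'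
  obtain ⟨g, hg⟩ := map_castRingHom_eq_zero_iff (m := m) (h := h - S * q).1 (by simp [hq'])
  exact ⟨q, g, by rw [← hg]; ring⟩

theorem exists_expand_eq_pow_add (S : ℤ[X]) {p : ℕ} (hp : p.Prime) :
    ∃ F : ℤ[X], expand ℤ p S = S ^ p + (p : ℤ[X]) * F := by
  have : Fact p.Prime := ⟨hp⟩
  obtain ⟨F, hF⟩ := map_castRingHom_eq_zero_iff (m := p) (h := expand ℤ p S - S ^ p).1
    (by simp [map_expand, ZMod.expand_card])
  exact ⟨F, by rw [← hF]; ring⟩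

theorem map_pow_dvd_map_of_aeval_eq {p : ℕ} {S F : ℤ[X]} {R : Type*} [CommRing R] [IsDomain R]
    [CharZero R] {θ : R} (hθ : IsIntegral ℤ θ)
    (hmin : minpoly ℤ θ = S ^ p + (p : ℤ[X]) * F) {h g : ℤ[X]}
    (heq : aeval θ h = p * aeval θ g) :
    S.map (Int.castRingHom (ZMod p)) ^ p ∣ h.map (Int.castRingHom (ZMod p)) := by
  have hd : minpoly ℤ θ ∣ h - (p : ℤ[X]) * g :=
    minpoly.isIntegrallyClosed_dvd hθ (by simp [heq])
  have := map_dvd (mapRingHom (Int.castRingHom (ZMod p))) hd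
  rw [hmin] at this
  simpa using this

theorem exists_notMem_adjoin_of_prime_smul {p : ℕ} {S F : ℤ[X]} {R : Type*} [CommRing R] {θ : R}
    (hmin : minpoly ℤ θ = S ^ p + (p : ℤ[X]) * F) {z : R} (hz : z ∉ Algebra.adjoin ℤ {θ})
    {n : ℕ} (hn : (p : R) ^ n * z ∈ Algebra.adjoin ℤ {θ}) :
    ∃ α : R, α ∉ Algebra.adjoin ℤ {θ} ∧ (p : R) * α ∈ Algebra.adjoin ℤ {θ} ∧
      aeval θ S * α ∈ Algebra.adjoin ℤ {θ} := by
  have step : ∀ (y z : R) (n : ℕ), z ∉ Algebra.adjoin ℤ {θ} → y ^ n * z ∈ Algebra.adjoin ℤ {θ} →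
      ∃ m, y ^ m * z ∉ Algebra.adjoin ℤ {θ} ∧ y * (y ^ m * z) ∈ Algebra.adjoin ℤ {θ} := by
    intro y z n hz hn
    induction n with
    | zero => exact absurd (by simpa using hn) hz
    | succ n ih =>
      by_cases h : y ^ n * z ∈ Algebra.adjoin ℤ {θ}
      · exact ih h
      · exact ⟨n, h, by rwa [← mul_assoc, ← pow_succ']⟩
  obtain ⟨m, hm, hpm⟩ := step _ _ _ hz hn
  have h0 : aeval θ S ^ p = - (p * aeval θ F) := by
    have := minpoly.aeval ℤ θ
    rw [hmin] at this
    simp only [map_add, map_pow, map_mul, map_natCast] at this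
    linear_combination this
  obtain ⟨j, hj, hSj⟩ := step (aeval θ S) _ p hm (by
    rw [h0, show -(p * aeval θ F) * ((p : R) ^ m * z) = -(aeval θ F * (p * (p ^ m * z))) by ring]
    exact neg_mem (mul_mem (aeval_mem_adjoin_singleton ℤ θ) hpm))
  refine ⟨_, hj, ?_, hSj⟩
  rw [mul_left_comm]
  exact mul_mem (pow_mem (aeval_mem_adjoin_singleton ℤ θ) j) hpm

theorem map_dvd_map_of_adjoin_ne_top {p : ℕ} {S F : ℤ[X]} {R : Type*} [CommRing R] [IsDomain R]
    [CharZero R] {θ : R}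
    (hp : p.Prime) (hpR : ¬ IsUnit (p : R))
    (hirr : Irreducible (S.map (Int.castRingHom (ZMod p)))) (hθ : IsIntegral ℤ θ)
    (hmin : minpoly ℤ θ = S ^ p + (p : ℤ[X]) * F)
    (htors : ∀ z : R, ∃ n : ℕ, (p : R) ^ n * z ∈ Algebra.adjoin ℤ {θ})
    (hne : Algebra.adjoin ℤ {θ} ≠ ⊤) :
    S.map (Int.castRingHom (ZMod p)) ∣ F.map (Int.castRingHom (ZMod p)) := by
  have : Fact p.Prime := ⟨hp⟩
  by_contra hF
  obtain ⟨z, hz⟩ : ∃ z, z ∉ Algebra.adjoin ℤ {θ} := by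
    by_contra! h
    exact hne (eq_top_iff.2 fun z _ => h z)
  obtain ⟨n, hn⟩ := htors z
  obtain ⟨α, hα, hpα, hSα⟩ := exists_notMem_adjoin_of_prime_smul hmin hz hn
  have h0 : aeval θ S ^ p = - (p * aeval θ F) := by
    have := minpoly.aeval ℤ θ
    rw [hmin] at this
    simp only [map_add, map_pow, map_mul, map_natCast] at this
    linear_combination this
  have hp0 : (p : R) ≠ 0 := Nat.cast_ne_zero.2 hp.ne_zero
  rw [Algebra.adjoin_singleton_eq_range_aeval] at hpα hSα
  obtain ⟨h, hh⟩ := hpα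
  obtain ⟨g, hg⟩ := hSα
  change aeval θ h = _ at hh
  change aeval θ g = _ at hg
  have hd := map_pow_dvd_map_of_aeval_eq (h := S * h) (g := g) hθ hmin (by
    rw [map_mul, hh, hg]; ring)
  obtain ⟨q, rfl⟩ : ∃ q, p = q + 1 := ⟨p - 1, by have := hp.pos; omega⟩
  rw [Polynomial.map_mul, pow_succ', mul_dvd_mul_iff_left hirr.ne_zero, ← Polynomial.map_pow] at hd
  obtain ⟨c, e, rfl⟩ := exists_eq_mul_add_of_map_dvd hd
  have hc : ¬ S.map (Int.castRingHom (ZMod (q + 1))) ∣ c.map (Int.castRingHom (ZMod (q + 1))) := by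
    intro hdc
    obtain ⟨c', e', rfl⟩ := exists_eq_mul_add_of_map_dvd hdc
    refine hα ?_
    have : α = aeval θ (-F * c' + S ^ q * e' + e) := by
      apply mul_left_cancel₀ hp0
      rw [← hh]
      simp only [map_add, map_mul, map_pow, map_natCast, map_neg]
      linear_combination (aeval θ c') * h0
    rw [this]
    exact aeval_mem_adjoin_singleton ℤ θ
  have hFc : ¬ S.map (Int.castRingHom (ZMod (q + 1))) ∣
      (F * c).map (Int.castRingHom (ZMod (q + 1))) := by
    rw [Polynomial.map_mul]
    exact fun h => (hirr.prime.dvd_or_dvd h).elim hF hc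
  obtain ⟨u', v', huv⟩ := (Irreducible.coprime_iff_not_dvd hirr).2 hFc
  obtain ⟨u, rfl⟩ := map_surjective (Int.castRingHom (ZMod (q + 1))) ZMod.intCast_surjective u'
  obtain ⟨v, rfl⟩ := map_surjective (Int.castRingHom (ZMod (q + 1))) ZMod.intCast_surjective v'
  obtain ⟨w, hw⟩ := map_castRingHom_eq_zero_iff (m := q + 1) (h := u * S + v * (F * c) - 1).1
    (by simpa [sub_eq_zero] using huv)
  have hkey : aeval θ F * aeval θ c = aeval θ S * aeval θ e - aeval θ S * α := by
    apply mul_left_cancel₀ hp0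
    simp only [map_add, map_mul, map_pow, map_natCast] at hh
    linear_combination aeval θ c * h0 - aeval θ S * hh
  have hw' := congrArg (aeval θ) hw
  simp only [map_add, map_sub, map_mul, map_natCast, map_one] at hw'
  have hco : IsCoprime (aeval θ S) (((q + 1 : ℕ) : R)) := by
    refine ⟨aeval θ u + aeval θ v * (aeval θ e - α), - aeval θ w, ?_⟩
    linear_combination hw' - aeval θ v * hkey
  have hco' := hco.pow_left (m := q + 1)
  rw [h0] at hco'
  obtain ⟨a, b, hab⟩ := hco'
  exact hpR (IsUnit.of_mul_eq_one (b - a * aeval θ F) (by linear_combination hab))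

theorem adjoin_ne_top_of_map_dvd_map {p : ℕ} {S F : ℤ[X]} {L : Type*} [Field L] [NumberField L]
    {θ : NumberField.RingOfIntegers L} (hp : p.Prime)
    (hirr : Irreducible (S.map (Int.castRingHom (ZMod p))))
    (hmin : minpoly ℤ θ = S ^ p + (p : ℤ[X]) * F)
    (hd : S.map (Int.castRingHom (ZMod p)) ∣ F.map (Int.castRingHom (ZMod p))) :
    Algebra.adjoin ℤ {θ} ≠ ⊤ := by
  have : Fact p.Prime := ⟨hp⟩
  intro htop
  obtain ⟨G, H, rfl⟩ := exists_eq_mul_add_of_map_dvd hd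
  have hθ : IsIntegral ℤ θ := Algebra.IsIntegral.isIntegral θ
  obtain ⟨q, rfl⟩ : ∃ q, p = q + 2 := ⟨p - 2, by have := hp.two_le; omega⟩
  have h0 : aeval θ S ^ (q + 2) + (q + 2 : ℕ) *
      (aeval θ S * aeval θ G + (q + 2 : ℕ) * aeval θ H) = 0 := by
    have := minpoly.aeval ℤ θ
    rw [hmin] at this
    simpa only [map_add, map_pow, map_mul, map_natCast] using this
  have hp0 : ((q + 2 : ℕ) : L) ≠ 0 := Nat.cast_ne_zero.2 hp.ne_zero
  obtain ⟨β, hβ⟩ : ∃ β : NumberField.RingOfIntegers L,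
      (q + 2 : ℕ) * β = aeval θ S ^ (q + 1) := by
    set s : L := algebraMap (NumberField.RingOfIntegers L) L (aeval θ S) with hs
    have h0' := congrArg (algebraMap (NumberField.RingOfIntegers L) L) h0
    simp only [map_add, map_mul, map_pow, map_natCast, map_zero] at h0'
    have hinteg : IsIntegral (NumberField.RingOfIntegers L) (s ^ (q + 1) / (q + 2 : ℕ)) := by
      refine ⟨X ^ 2 + C (aeval θ G) * X + C (aeval θ S ^ q * aeval θ H), by monicity!, ?_⟩
      simp only [eval₂_add, eval₂_mul, eval₂_pow, eval₂_X, eval₂_C, map_mul, map_pow]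
      field_simp
      linear_combination s ^ q * h0'
    obtain ⟨β, hβ⟩ := IsIntegrallyClosed.isIntegral_iff.1 hinteg
    refine ⟨β, NumberField.RingOfIntegers.ext ?_⟩
    change algebraMap _ L _ = algebraMap _ L _
    rw [map_mul, map_natCast, hβ, map_pow, mul_div_cancel₀ _ hp0]
  have hβm : β ∈ Algebra.adjoin ℤ {θ} := htop ▸ Algebra.mem_top
  rw [Algebra.adjoin_singleton_eq_range_aeval] at hβm
  obtain ⟨g, hg⟩ := hβm
  change aeval θ g = _ at hg
  have := map_pow_dvd_map_of_aeval_eq (h := S ^ (q + 1)) (g := g) hθ hmin (by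
    rw [hg, hβ, map_pow])
  rw [Polynomial.map_pow, pow_dvd_pow_iff hirr.ne_zero hirr.not_isUnit] at this
  omega

theorem pow_eq_self_iff_orderOf_dvd {M : Type*} [CommMonoid M] {y : M} (hy : IsUnit y) {n : ℕ}
    (hn : 0 < n) : y ^ n = y ↔ orderOf y ∣ n - 1 := by
  rw [orderOf_dvd_iff_pow_eq_one]
  nth_rw 1 [← Nat.sub_add_cancel hn]
  rw [Nat.succ_eq_add_one, zero_add, pow_succ]
  exact hy.mul_eq_right

section ReductionModSquare

variable {T K : Type*} [CommRing T] [CommRing K] {p d : ℕ} {S : ℤ[X]} {x : T}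

theorem aeval_pow_char_eq_pow [Fact p.Prime] [CharP K p] (S : ℤ[X]) (y : K) :
    aeval (y ^ p) S = aeval y S ^ p := by
  obtain ⟨F, hF⟩ := exists_expand_eq_pow_add S (Fact.out : p.Prime)
  rw [← expand_aeval, hF]
  simp

theorem isUnit_of_map_ne_zero [IsDomain K] [Finite K] (hp2 : (p : T) ^ 2 = 0) {π : T →ₐ[ℤ] K}
    (hπ : Function.Surjective π) (hker : ∀ y, π y = 0 → (p : T) ∣ y) {y : T} (hy : π y ≠ 0) :
    IsUnit y := by
  obtain ⟨z', hz'⟩ := (Finite.isField_of_domain K).mul_inv_cancel hy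
  obtain ⟨z, rfl⟩ := hπ z'
  obtain ⟨v, hv⟩ := hker (y * z - 1) (by simp [hz'])
  exact IsUnit.of_mul_eq_one (z * (1 - p * v))
    (by linear_combination (1 - p * v) * hv - v ^ 2 * hp2)

theorem aeval_pow_pow_eq_zero (hlift : ∀ τ : T, aeval τ S = 0 → ∃ φ : T →ₐ[ℤ] T, φ x = τ)
    (hx : aeval x S = 0) (h : aeval (x ^ p) S = 0) (n : ℕ) : aeval (x ^ p ^ n) S = 0 := by
  induction n with
  | zero => simpa
  | succ n ih =>
    obtain ⟨φ, hφ⟩ := hlift _ h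
    have := congrArg φ ih
    rwa [← aeval_algHom_apply, map_pow, hφ, ← pow_mul, ← pow_succ', map_zero] at this

theorem pow_eq_pow_of_dvd_sub [Fact p.Prime] (hp2 : (p : T) ^ 2 = 0) {a b : T}
    (h : (p : T) ∣ a - b) : a ^ p = b ^ p := by
  have := dvd_sub_pow_of_dvd_sub h 1
  simpa [hp2, sub_eq_zero] using this

theorem pow_pow_eq_self_of_aeval_pow_eq_zero [IsDomain K] [Finite K]
    (hp2 : (p : T) ^ 2 = 0) {π : T →ₐ[ℤ] K}
    (hπ : Function.Surjective π) (hker : ∀ y, π y = 0 → (p : T) ∣ y)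
    (hlift : ∀ τ : T, aeval τ S = 0 → ∃ φ : T →ₐ[ℤ] T, φ x = τ)
    (hx : aeval x S = 0) (hfrob : π x ^ p ^ d = π x)
    (hsep : aeval (π x) (derivative S) ≠ 0) (h : aeval (x ^ p) S = 0) : x ^ p ^ d = x := by
  obtain ⟨z, hz⟩ := hker (x ^ p ^ d - x) (by simp [hfrob])
  have h0 := aeval_pow_pow_eq_zero hlift hx h d
  rw [← sub_add_cancel (x ^ p ^ d) x, hz, add_comm,
    aeval_add_of_sq_eq_zero _ _ _ (by rw [mul_pow, hp2, zero_mul]), hx, zero_add] at h0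
  rw [aeval_algHom_apply] at hsep
  rw [(isUnit_of_map_ne_zero hp2 hπ hker hsep).mul_right_eq_zero] at h0
  rwa [h0, sub_eq_zero] at hz

theorem aeval_pow_eq_zero_of_pow_pow_eq_self [IsDomain K] [Finite K]
    [Fact p.Prime] [CharP K p] (hp2 : (p : T) ^ 2 = 0)
    {π : T →ₐ[ℤ] K} (hπ : Function.Surjective π) (hker : ∀ y, π y = 0 → (p : T) ∣ y)
    (hlift : ∀ τ : T, aeval τ S = 0 → ∃ φ : T →ₐ[ℤ] T, φ x = τ) (hx : aeval x S = 0)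
    (hsep : aeval (π x) (derivative S) ≠ 0) (hd : d ≠ 0) (h : x ^ p ^ d = x) :
    aeval (x ^ p) S = 0 := by
  obtain ⟨y, hy⟩ := hker (aeval (x ^ p) S) (by
    rw [← aeval_algHom_apply, map_pow, aeval_pow_char_eq_pow, aeval_algHom_apply, hx, map_zero,
      zero_pow (NeZero.ne p)])
  obtain ⟨u, hu⟩ := isUnit_of_map_ne_zero hp2 hπ hker (y := aeval (x ^ p) (derivative S)) (by
    rw [← aeval_algHom_apply, map_pow, aeval_pow_char_eq_pow]
    exact pow_ne_zero _ hsep)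
  obtain ⟨φ, hφ⟩ := hlift (x ^ p + p * (-(↑u⁻¹ * y))) (by
    rw [aeval_add_of_sq_eq_zero _ _ _ (by rw [mul_pow, hp2, zero_mul]), hy, ← hu]
    linear_combination (-(p : T) * y) * u.mul_inv)
  have h1 := congrArg φ h
  obtain ⟨e, rfl⟩ := Nat.exists_eq_succ_of_ne_zero hd
  have h2 : (φ x) ^ p = (x ^ p) ^ p :=
    pow_eq_pow_of_dvd_sub hp2 ⟨-(↑u⁻¹ * y), by rw [hφ]; ring⟩
  rw [map_pow, pow_succ', pow_mul, h2, ← pow_mul, ← pow_succ', ← pow_mul, mul_comm p, pow_mul, h]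
    at h1
  rw [h1, aeval_algHom_apply, hx, map_zero]

theorem pow_pow_eq_self_iff_orderOf_eq [IsDomain K] [Finite K]
    [Fact p.Prime] (hp2 : (p : T) ^ 2 = 0)
    {π : T →ₐ[ℤ] K} (hπ : Function.Surjective π) (hker : ∀ y, π y = 0 → (p : T) ∣ y)
    (hx0 : π x ≠ 0) (hfrob : π x ^ p ^ d = π x) (hd : d ≠ 0) :
    x ^ p ^ d = x ↔ orderOf x = orderOf (π x) := by
  rw [pow_eq_self_iff_orderOf_dvd (isUnit_of_map_ne_zero hp2 hπ hker hx0) (NeZero.pos _)]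
  have hx0' : IsUnit (π x) := (isUnit_of_map_ne_zero hp2 hπ hker hx0).map π
  rw [pow_eq_self_iff_orderOf_dvd hx0' (NeZero.pos _)] at hfrob
  refine ⟨fun h => Nat.dvd_antisymm ?_ (orderOf_map_dvd (π : T →* K) x), fun h => h ▸ hfrob⟩
  have hco : (orderOf x).Coprime p :=
    Nat.Coprime.coprime_dvd_left h ((Nat.coprime_self_sub_left (NeZero.one_le (n := p ^ d))).2
      (Nat.coprime_one_left _) |>.coprime_dvd_right (dvd_pow_self p hd))
  refine hco.dvd_of_dvd_mul_right ?_
  rw [orderOf_dvd_iff_pow_eq_one, pow_mul]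
  simpa using pow_eq_pow_of_dvd_sub (b := 1) hp2
    (hker (x ^ orderOf (π x) - 1) (by simp [pow_orderOf_eq_one]))

/-- The order of a root of `S` in `T` is preserved under reduction modulo `p` if and only if `S`
vanishes at the `p`-th power of that root. -/
theorem orderOf_eq_iff_aeval_pow_eq_zero [IsDomain K] [Finite K]
    [Fact p.Prime] [CharP K p] (hp2 : (p : T) ^ 2 = 0)
    {π : T →ₐ[ℤ] K} (hπ : Function.Surjective π) (hker : ∀ y, π y = 0 → (p : T) ∣ y)
    (hlift : ∀ τ : T, aeval τ S = 0 → ∃ φ : T →ₐ[ℤ] T, φ x = τ) (hx : aeval x S = 0)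
    (hx0 : π x ≠ 0) (hsep : aeval (π x) (derivative S) ≠ 0) (hfrob : π x ^ p ^ d = π x)
    (hd : d ≠ 0) : orderOf x = orderOf (π x) ↔ aeval (x ^ p) S = 0 := by
  rw [← pow_pow_eq_self_iff_orderOf_eq hp2 hπ hker hx0 hfrob hd]
  exact ⟨aeval_pow_eq_zero_of_pow_pow_eq_self hp2 hπ hker hlift hx hsep hd,
    pow_pow_eq_self_of_aeval_pow_eq_zero hp2 hπ hker hlift hx hfrob hsep⟩

end ReductionModSquare

/-- The quotient of `ℤ[X]` by the ideal generated by `S` and `m`. -/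
def AdjoinRootMod (m : ℕ) (S : ℤ[X]) : Type :=
  AdjoinRoot (S.map (Int.castRingHom (ZMod m)))

namespace AdjoinRootMod

variable {m : ℕ} {S : ℤ[X]}

noncomputable instance : CommRing (AdjoinRootMod m S) :=
  inferInstanceAs (CommRing (AdjoinRoot (S.map (Int.castRingHom (ZMod m)))))

/-- The class of the variable. -/
noncomputable def root (m : ℕ) (S : ℤ[X]) : AdjoinRootMod m S :=
  AdjoinRoot.root (S.map (Int.castRingHom (ZMod m)))

/-- The structure map from `ℤ/m`. -/
noncomputable def of (m : ℕ) (S : ℤ[X]) : ZMod m →+* AdjoinRootMod m S :=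
  AdjoinRoot.of (S.map (Int.castRingHom (ZMod m)))

theorem aeval_root_eq_mk (h : ℤ[X]) : aeval (root m S) h =
    AdjoinRoot.mk (S.map (Int.castRingHom (ZMod m))) (h.map (Int.castRingHom (ZMod m))) := by
  let ψ : ℤ[X] →+* AdjoinRootMod m S :=
    (AdjoinRoot.mk (S.map (Int.castRingHom (ZMod m)))).comp (mapRingHom (Int.castRingHom (ZMod m)))
  have hψ : ψ X = root m S := by
    change AdjoinRoot.mk _ (X.map _) = _
    rw [map_X]
    rfl
  rw [← hψ]
  exact (aeval_algHom_apply ψ.toIntAlgHom X h).trans (congrArg ψ (aeval_X_left_apply h))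

theorem exists_aeval_root_eq (y : AdjoinRootMod m S) : ∃ h : ℤ[X], aeval (root m S) h = y := by
  obtain ⟨h', rfl⟩ := AdjoinRoot.mk_surjective y
  obtain ⟨h, rfl⟩ := map_surjective (Int.castRingHom (ZMod m)) ZMod.intCast_surjective h'
  exact ⟨h, aeval_root_eq_mk h⟩

theorem aeval_root_eq_zero_iff {h : ℤ[X]} : aeval (root m S) h = 0 ↔
    S.map (Int.castRingHom (ZMod m)) ∣ h.map (Int.castRingHom (ZMod m)) := by
  rw [aeval_root_eq_mk, ← AdjoinRoot.mk_eq_zero]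
  rfl

theorem aeval_root_self : aeval (root m S) S = 0 :=
  aeval_root_eq_zero_iff.2 dvd_rfl

theorem exists_algHom_of_aeval_eq_zero {A : Type*} [CommRing A] (f : ZMod m →+* A) {τ : A}
    (hτ : aeval τ S = 0) : ∃ φ : AdjoinRootMod m S →ₐ[ℤ] A, φ (root m S) = τ := by
  have h : (S.map (Int.castRingHom (ZMod m))).eval₂ f τ = 0 := by
    rw [eval₂_map, ← hτ, aeval_def, RingHom.ext_int (algebraMap ℤ A)]
  let φ : AdjoinRootMod m S →+* A := AdjoinRoot.lift f τ h
  exact ⟨φ.toIntAlgHom, AdjoinRoot.lift_root h⟩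

theorem isDomain (hirr : Prime (S.map (Int.castRingHom (ZMod m)))) :
    IsDomain (AdjoinRootMod m S) :=
  AdjoinRoot.isDomain_of_prime hirr

theorem finite [NeZero m] (hS : S.Monic) : Finite (AdjoinRootMod m S) := by
  have := (hS.map (Int.castRingHom (ZMod m))).finite_adjoinRoot
  exact Module.finite_of_finite (ZMod m) (M := AdjoinRoot (S.map (Int.castRingHom (ZMod m))))

theorem root_pow_card_pow_natDegree [Fact m.Prime]
    (hirr : Irreducible (S.map (Int.castRingHom (ZMod m)))) :
    root m S ^ m ^ (S.map (Int.castRingHom (ZMod m))).natDegree = root m S := by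
  have : Fact (Irreducible (S.map (Int.castRingHom (ZMod m)))) := ⟨hirr⟩
  have := (AdjoinRoot.powerBasis hirr.ne_zero).finite
  have : Finite (AdjoinRoot (S.map (Int.castRingHom (ZMod m)))) := Module.finite_of_finite (ZMod m)
  have := Fintype.ofFinite (AdjoinRoot (S.map (Int.castRingHom (ZMod m))))
  have hcard : Fintype.card (AdjoinRoot (S.map (Int.castRingHom (ZMod m)))) =
      m ^ (S.map (Int.castRingHom (ZMod m))).natDegree := by
    rw [Module.card_eq_pow_finrank (K := ZMod m), ZMod.card,
      (AdjoinRoot.powerBasis hirr.ne_zero).finrank, AdjoinRoot.powerBasis_dim]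
  rw [← hcard]
  exact FiniteField.pow_card (AdjoinRoot.root (S.map (Int.castRingHom (ZMod m))))

theorem orderOf_root_eq_iff_map_dvd_map {p : ℕ} {F : ℤ[X]} (hp : p.Prime) (hS : S.Monic)
    (hS0 : S.eval 0 = -1) (hirr : Irreducible (S.map (Int.castRingHom (ZMod p))))
    (hF : expand ℤ p S = S ^ p + (p : ℤ[X]) * F) :
    orderOf (root (p ^ 2) S) = orderOf (root p S) ↔
      S.map (Int.castRingHom (ZMod p)) ∣ F.map (Int.castRingHom (ZMod p)) := by
  have : Fact p.Prime := ⟨hp⟩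
  have hdom : IsDomain (AdjoinRootMod p S) := isDomain hirr.prime
  have hfin : Finite (AdjoinRootMod p S) := finite hS
  have hchar : CharP (AdjoinRootMod p S) p := charP_of_injective_ringHom (of p S).injective p
  have hp2 : (p : AdjoinRootMod (p ^ 2) S) ^ 2 = 0 := by
    have := congrArg (of (p ^ 2) S) (ZMod.natCast_self (p ^ 2))
    rwa [map_natCast, map_zero, Nat.cast_pow] at this
  have hxS := aeval_root_self (m := p ^ 2) (S := S)
  have hρS := aeval_root_self (m := p) (S := S)
  obtain ⟨π, hπ⟩ := exists_algHom_of_aeval_eq_zero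
    ((of p S).comp (ZMod.castHom (dvd_pow_self p two_ne_zero) (ZMod p))) hρS
  have hsurj : Function.Surjective π := by
    intro y
    obtain ⟨h, rfl⟩ := exists_aeval_root_eq y
    exact ⟨aeval (root (p ^ 2) S) h, by rw [← aeval_algHom_apply, hπ]⟩
  have hker : ∀ y, π y = 0 → (p : AdjoinRootMod (p ^ 2) S) ∣ y := by
    intro y hy
    obtain ⟨h, rfl⟩ := exists_aeval_root_eq y
    rw [← aeval_algHom_apply, hπ, aeval_root_eq_zero_iff] at hy
    obtain ⟨q, g, rfl⟩ := exists_eq_mul_add_of_map_dvd hy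
    exact ⟨aeval (root (p ^ 2) S) g, by simp [hxS]⟩
  have hρ0 : root p S ≠ 0 := by
    intro h0
    rw [h0, ← coeff_zero_eq_aeval_zero', coeff_zero_eq_eval_zero, hS0] at hρS
    simp at hρS
  have hsep : aeval (root p S) (derivative S) ≠ 0 := by
    rw [Ne, aeval_root_eq_zero_iff, ← derivative_map]
    intro h
    exact hirr.not_isUnit
      ((PerfectField.separable_of_irreducible hirr).isUnit_of_dvd' dvd_rfl h)
  have key := orderOf_eq_iff_aeval_pow_eq_zero (d := (S.map (Int.castRingHom (ZMod p))).natDegree)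
    hp2 hsurj hker (fun τ hτ => exists_algHom_of_aeval_eq_zero (of _ _) hτ)
    hxS (by rwa [hπ]) (by rwa [hπ]) (by rw [hπ, root_pow_card_pow_natDegree hirr])
    hirr.natDegree_pos.ne'
  rw [hπ] at key
  rw [key, ← expand_aeval, hF]
  simp only [map_add, map_mul, map_pow, hxS, map_natCast, zero_pow hp.ne_zero, zero_add]
  have hpF : (p : AdjoinRootMod (p ^ 2) S) * aeval (root (p ^ 2) S) F =
      aeval (root (p ^ 2) S) ((p : ℤ[X]) * F) := by simp
  have hp0 : (p : ℤ[X]) ≠ 0 := Nat.cast_ne_zero.2 hp.ne_zero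
  constructor
  · intro h
    rw [hpF, aeval_root_eq_zero_iff] at h
    obtain ⟨q, g, hqg⟩ := exists_eq_mul_add_of_map_dvd h
    have hq := congrArg (Polynomial.map (Int.castRingHom (ZMod p))) hqg
    simp [hirr.ne_zero] at hq
    obtain ⟨q', rfl⟩ := map_castRingHom_eq_zero_iff.1 hq
    have : F = S * q' + (p : ℤ[X]) * g := by
      apply mul_left_cancel₀ hp0
      rw [hqg]
      push_cast
      ring
    rw [this]
    simp
  · intro h
    obtain ⟨q, g, rfl⟩ := exists_eq_mul_add_of_map_dvd h
    simp only [map_add, map_mul, hxS, map_natCast]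
    linear_combination aeval (root (p ^ 2) S) g * hp2

end AdjoinRootMod

theorem eq_zero_of_aeval_root_quadratic_eq_zero {m : ℕ} {S : ℤ[X]} (hm : 1 < m) (hS : S.Monic)
    (hdeg : S.natDegree = 3) {a b c : ℤ}
    (h : (a : AdjoinRootMod m S) * AdjoinRootMod.root m S ^ 2 +
      b * AdjoinRootMod.root m S + c = 0) :
    (a : ZMod m) = 0 ∧ (b : ZMod m) = 0 ∧ (c : ZMod m) = 0 := by
  have : Fact (1 < m) := ⟨hm⟩
  have h' : aeval (AdjoinRootMod.root m S) (C a * X ^ 2 + C b * X + C c) = 0 := by simpa using h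
  rw [AdjoinRootMod.aeval_root_eq_zero_iff] at h'
  have h0 : (C a * X ^ 2 + C b * X + C c).map (Int.castRingHom (ZMod m)) = 0 := by
    by_contra hne
    refine (hS.map _).not_dvd_of_natDegree_lt hne ?_ h'
    rw [hS.natDegree_map, hdeg]
    refine lt_of_le_of_lt natDegree_map_le (lt_of_le_of_lt natDegree_quadratic_le (by norm_num))
  have hc := fun n => congrArg (coeff · n) h0
  exact ⟨by simpa [-eq_intCast, -map_intCast, coeff_X, coeff_C] using hc 2,
    by simpa [-eq_intCast, -map_intCast, coeff_X, coeff_C] using hc 1,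
    by simpa [-eq_intCast, -map_intCast, coeff_X, coeff_C] using hc 0⟩

theorem pow_eq_shanksSeq {A : Type*} [CommRing A] {k : ℤ} {x : A}
    (hx : aeval x (shanksPoly k) = 0) (n : ℕ) :
    x ^ n = shanksSeq k n * x ^ 2 + (shanksSeq k (n + 1) - k * shanksSeq k n) * x +
      (shanksSeq k (n + 2) - k * shanksSeq k (n + 1) - (k + 3) * shanksSeq k n) := by
  rw [aeval_shanksPoly] at hx
  induction n with
  | zero => simp [shanksSeq]
  | succ n ih =>
    rw [pow_succ, ih, show n + 1 + 2 = n + 3 from rfl, shanksSeq]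
    push_cast
    linear_combination (shanksSeq k n : A) * hx

theorem sInf_pow_eq_one_eq_orderOf {M : Type*} [Monoid M] (x : M) :
    sInf {n : ℕ | 0 < n ∧ x ^ n = 1} = orderOf x := by
  by_cases hx : IsOfFinOrder x
  · have hmem : orderOf x ∈ {n : ℕ | 0 < n ∧ x ^ n = 1} := ⟨hx.orderOf_pos, pow_orderOf_eq_one x⟩
    have := Nat.sInf_mem ⟨_, hmem⟩
    exact le_antisymm (Nat.sInf_le hmem) (orderOf_le_of_pow_eq_one this.1 this.2)
  · rw [orderOf_eq_zero hx, Nat.sInf_eq_zero]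
    refine Or.inr (Set.eq_empty_of_forall_notMem fun n hn => hx ?_)
    exact isOfFinOrder_iff_pow_eq_one.2 ⟨n, hn⟩

theorem shanksPeriod_eq_orderOf (k : ℤ) {m : ℕ} (hm : 1 < m) :
    shanksPeriod k m = orderOf (AdjoinRootMod.root m (shanksPoly k)) := by
  set x := AdjoinRootMod.root m (shanksPoly k) with hx
  have hpow := pow_eq_shanksSeq (AdjoinRootMod.aeval_root_self (m := m) (S := shanksPoly k))
  rw [← hx] at hpow
  rw [shanksPeriod, ← sInf_pow_eq_one_eq_orderOf]
  congr 1
  ext n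
  refine and_congr_right fun _ => ⟨fun h => ?_, fun h j => ?_⟩
  · have h' : ∀ j, ((shanksSeq k (j + n) : ℤ) : AdjoinRootMod m (shanksPoly k)) =
        (shanksSeq k j : ℤ) := by
      intro j
      simpa using congrArg (AdjoinRootMod.of m (shanksPoly k)) (h j)
    rw [hpow n, add_comm n 1, add_comm n 2, h' 1, h' 2, ← zero_add n, h' 0]
    simp [shanksSeq]
  · have hj : x ^ (j + n) = x ^ j := by rw [pow_add, h, mul_one]
    have hq := (eq_zero_of_aeval_root_quadratic_eq_zero hm (shanksPoly_monic k)
      (shanksPoly_natDegree k) (a := shanksSeq k (j + n) - shanksSeq k j)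
      (b := shanksSeq k (j + n + 1) - k * shanksSeq k (j + n) -
        (shanksSeq k (j + 1) - k * shanksSeq k j))
      (c := shanksSeq k (j + n + 2) - k * shanksSeq k (j + n + 1) - (k + 3) * shanksSeq k (j + n) -
        (shanksSeq k (j + 2) - k * shanksSeq k (j + 1) - (k + 3) * shanksSeq k j)) (by
      rw [hpow, hpow j] at hj
      push_cast
      linear_combination hj)).1
    simpa [sub_eq_zero] using hq

theorem natCast_not_isUnit_ringOfIntegers {L : Type*} [Field L] [NumberField L] {p : ℕ}
    (hp : p.Prime) : ¬ IsUnit (p : NumberField.RingOfIntegers L) := by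
  intro h
  have h' : IsUnit (algebraMap ℤ (NumberField.RingOfIntegers L) p) := by simpa using h
  have := (Algebra.IsIntegral.isLocalHom (R := ℤ)
    (S := NumberField.RingOfIntegers L)).map_nonunit _ h'
  rw [Int.isUnit_iff] at this
  have := hp.two_le
  omega

/-- Let `k ≥ 1` with `k ≢ 3 (mod 9)` be such that `D` is
squarefree, and let `p` be a prime such that the Shanks polynomial
`S_k(x) = x³ − k·x² − (k+3)·x − 1` is irreducible in `𝔽_p[x]`.  Then `p` is a
`k`-Shanks prime if and only if `S_k(x^p)` is non-monogenic, i.e. for `θ` a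
root of `S_k(x^p)` generating `L = ℚ(θ)`, the ring of integers of `L` is not
`ℤ[θ]`. -/
theorem shanks_prime_iff_nonmonogenic (k : ℤ) (hk : 1 ≤ k) (hk9 : ¬ k ≡ 3 [ZMOD 9])
    (hD : Squarefree (if (3 : ℤ) ∣ k then (k / 3) ^ 2 + k / 3 + 1 else k ^ 2 + 3 * k + 9))
    (p : ℕ) (hp : p.Prime)
    (hirr : Irreducible (X ^ 3 - C (k : ZMod p) * X ^ 2 - C ((k : ZMod p) + 3) * X - 1))
    (L : Type*) [Field L] [NumberField L] (θ : NumberField.RingOfIntegers L)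
    (hθ : θ ^ (3 * p) - (k : NumberField.RingOfIntegers L) * θ ^ (2 * p)
      - ((k : NumberField.RingOfIntegers L) + 3) * θ ^ p - 1 = 0)
    (hgen : ℚ⟮(θ : L)⟯ = ⊤) :
    IsShanksPrime k p ↔
      Algebra.adjoin ℤ ({θ} : Set (NumberField.RingOfIntegers L)) ≠ ⊤ := by
  have : Fact p.Prime := ⟨hp⟩
  have hirr' : Irreducible ((shanksPoly k).map (Int.castRingHom (ZMod p))) := by
    rwa [shanksPoly_map]
  have hS : Irreducible (shanksPoly k) :=
    (shanksPoly_monic k).irreducible_of_irreducible_map _ _ hirr'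
  have hθ' : aeval (θ ^ p) (shanksPoly k) = 0 := by
    rw [aeval_shanksPoly, ← hθ]
    ring
  obtain ⟨F, hF⟩ := exists_expand_eq_pow_add (shanksPoly k) hp
  have hmin : minpoly ℤ θ = shanksPoly k ^ p + (p : ℤ[X]) * F := by
    rw [← hF]
    exact minpoly_int_eq_of_irreducible ((shanksPoly_monic k).expand hp.pos)
      (expand_shanksPoly_irreducible hk hS hp) (by rwa [expand_aeval])
  have hθL : aeval ((θ : L) ^ p) (shanksPoly k) = 0 := by
    have := congrArg (algebraMap (NumberField.RingOfIntegers L) L) hθ'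
    rwa [map_zero, ← aeval_algebraMap_apply, map_pow] at this
  have htors : ∀ z : NumberField.RingOfIntegers L, ∃ n : ℕ,
      (p : NumberField.RingOfIntegers L) ^ n * z ∈ Algebra.adjoin ℤ {θ} := by
    intro z
    obtain ⟨n, hn⟩ := exists_prime_pow_smul_mem_adjoin hk hk9 hD hS hp hθL hgen
      (NumberField.RingOfIntegers.isIntegral_coe z)
    refine ⟨n, ?_⟩
    rw [Algebra.adjoin_singleton_eq_range_aeval] at hn ⊢
    obtain ⟨g, hg⟩ := hn
    refine ⟨g, NumberField.RingOfIntegers.ext ?_⟩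
    change aeval (θ : L) g = _ at hg
    change algebraMap _ L (aeval θ g) = algebraMap _ L _
    rw [← aeval_algebraMap_apply, hg]
    simp
  rw [IsShanksPrime, shanksPeriod_eq_orderOf k hp.one_lt,
    shanksPeriod_eq_orderOf k (Nat.one_lt_pow two_ne_zero hp.one_lt),
    AdjoinRootMod.orderOf_root_eq_iff_map_dvd_map hp (shanksPoly_monic k) (by simp [shanksPoly])
      hirr' hF, and_iff_right hp]
  exact ⟨adjoin_ne_top_of_map_dvd_map hp hirr' hmin,
    map_dvd_map_of_adjoin_ne_top hp (natCast_not_isUnit_ringOfIntegers hp) hirr'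
      (Algebra.IsIntegral.isIntegral θ) hmin htors⟩
end

section
/- Let k ≥ 1 be an integer with k ≢ 3 (mod 9) such that D is squarefree, and let p be a prime dividing k² + 3k + 9. Then the polynomial S_k(x^p) is monogenic; that is, if θ is a root of S_k(x^p) and L = ℚ(θ), then ℤ[θ] equals the ring of integers of L. -/
open Polynomial IntermediateField

section Saturation

variable {O : Type*} [CommRing O]

/-- An element of `A` divisible by `q` in an integral extension has a power divisible by `q`
in `A`. -/
theorem exists_pow_eq_mul_of_eq_mul {A : Subalgebra ℤ O} {q : ℕ} {y z : O} (hy : y ∈ A)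
    (hz : IsIntegral ℤ z) (hyz : y = q * z) : ∃ N : ℕ, ∃ a ∈ A, y ^ N = q * a := by
  obtain ⟨f, hf, hfz⟩ := hz
  refine ⟨f.natDegree, -∑ i ∈ Finset.range f.natDegree,
    (f.coeff i : O) * q ^ (f.natDegree - i - 1) * y ^ i, ?_, ?_⟩
  · exact A.neg_mem (A.sum_mem fun i _ => A.mul_mem (A.mul_mem (intCast_mem A _)
      (A.pow_mem (natCast_mem A _) _)) (A.pow_mem hy _))
  · rw [eval₂_eq_sum_range, Finset.sum_range_succ, hf.coeff_natDegree] at hfz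
    have h : z ^ f.natDegree = -∑ i ∈ Finset.range f.natDegree, (f.coeff i : O) * z ^ i := by
      rw [eq_neg_iff_add_eq_zero, add_comm]
      simpa using hfz
    rw [hyz, mul_pow, h, mul_neg, mul_neg, Finset.mul_sum, Finset.mul_sum]
    congr 1
    refine Finset.sum_congr rfl fun i hi => ?_
    have hi := Finset.mem_range.mp hi
    rw [mul_pow]
    conv_lhs => rw [show f.natDegree = 1 + (f.natDegree - i - 1) + i by omega, pow_add, pow_add]
    ring

/-- If `q` is, up to a factor prime to `q` modulo `u`, the `e`-th power of `u`, and `(q, u)` is a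
radical ideal of `A`, then `A` is saturated at `q` in every integral extension. -/
theorem mem_of_mul_mem_of_pow_eq [NoZeroDivisors O] [Algebra.IsIntegral ℤ O]
    (A : Subalgebra ℤ O) (q : ℕ) (hq0 : (q : O) ≠ 0) {u s : O} (hu : u ∈ A) (hs : s ∈ A)
    {m : ℤ} (hm : IsCoprime m (q : ℤ)) {e : ℕ} (hue : u ^ e = q * (m + u * s))
    (hrad : ∀ v ∈ A, ∀ n : ℕ, (∃ a ∈ A, ∃ b ∈ A, v ^ n = q * a + u * b) →
      ∃ a ∈ A, ∃ b ∈ A, v = q * a + u * b)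
    {z : O} (hz : (q : O) * z ∈ A) : z ∈ A := by
  obtain ⟨m', r, hmr⟩ := hm
  have hmr' : (m' : O) * m + r * q = 1 := by exact_mod_cast congrArg (Int.cast : ℤ → O) hmr
  have key : ∀ j ≤ e, ∃ v ∈ A, ∃ t ∈ A, (q : O) * z = u ^ j * v + q * t := by
    intro j
    induction j with
    | zero => exact fun _ => ⟨_, hz, 0, A.zero_mem, by simp⟩
    | succ j ih =>
      intro hj
      obtain ⟨v, hv, t, ht, h⟩ := ih (by omega)
      obtain ⟨d, rfl⟩ : ∃ d, e = j + (d + 1) := ⟨e - j - 1, by omega⟩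
      have h1 : (m + u * s) * v = u ^ (d + 1) * (z - t) := by
        apply mul_left_cancel₀ hq0
        rw [← mul_assoc, ← hue, pow_add]
        linear_combination (-u ^ (d + 1)) * h
      have h2 : v = u * (m' * (u ^ d * (z - t) - s * v)) + q * (r * v) := by
        linear_combination m' * h1 - v * hmr'
      have h3 : ∃ w, v ^ (j + (d + 1)) = q * w := by
        obtain ⟨w, hw⟩ := sub_dvd_pow_sub_pow v (u * (m' * (u ^ d * (z - t) - s * v)))
          (j + (d + 1))
        refine ⟨r * v * w + (m + u * s) * (m' * (u ^ d * (z - t) - s * v)) ^ (j + (d + 1)), ?_⟩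
        rw [mul_pow u, hue] at hw
        linear_combination hw + w * h2
      obtain ⟨w, hw⟩ := h3
      obtain ⟨N, a, ha, hN⟩ := exists_pow_eq_mul_of_eq_mul (A.pow_mem hv _)
        (Algebra.IsIntegral.isIntegral (R := ℤ) w) hw
      rw [← pow_mul] at hN
      obtain ⟨a, ha, b, hb, hab⟩ := hrad v hv _ ⟨a, ha, 0, A.zero_mem, by simpa using hN⟩
      refine ⟨b, hb, t + u ^ j * a, A.add_mem ht (A.mul_mem (A.pow_mem hu _) ha), ?_⟩
      rw [h, hab]
      ring
  obtain ⟨v, hv, t, ht, h⟩ := key e le_rfl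
  have : z = (m + u * s) * v + t := by
    apply mul_left_cancel₀ hq0
    rw [h, hue]
    ring
  rw [this]
  exact A.add_mem (A.mul_mem (A.add_mem (intCast_mem A m) (A.mul_mem hu hs)) hv) ht

/-- If `h` is squarefree modulo `q`, then `(q, h(θ))` is a radical ideal of `ℤ[θ]`. -/
theorem exists_eq_add_of_pow_eq_add_of_squarefree (θ : O) (q : ℕ) [Fact q.Prime] (h : ℤ[X])
    (hsq : Squarefree (h.map (Int.castRingHom (ZMod q)))) (v : O)
    (hv : v ∈ Algebra.adjoin ℤ {θ}) (n : ℕ)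
    (hn : ∃ a ∈ Algebra.adjoin ℤ {θ}, ∃ b ∈ Algebra.adjoin ℤ {θ},
      v ^ n = q * a + aeval θ h * b) :
    ∃ a ∈ Algebra.adjoin ℤ {θ}, ∃ b ∈ Algebra.adjoin ℤ {θ}, v = q * a + aeval θ h * b := by
  simp only [Algebra.adjoin_singleton_eq_range_aeval] at *
  obtain ⟨g, rfl⟩ := hv
  obtain ⟨_, ⟨a, rfl⟩, _, ⟨b, rfl⟩, hn⟩ := hn
  simp only [AlgHom.toRingHom_eq_coe, RingHom.coe_coe] at *
  set π := mapRingHom (Int.castRingHom (ZMod q)) with hπ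
  have hπs : Function.Surjective π := map_surjective _ (ZMod.ringHom_surjective _)
  have hq : π (q : ℤ[X]) = 0 := by rw [map_natCast]; simp
  set r : ℤ[X] := g ^ n - q * a - h * b with hr
  have hr0 : aeval θ r = 0 := by
    simp only [hr, map_sub, map_mul, map_pow, map_natCast]
    linear_combination hn
  have hd1 : EuclideanDomain.gcd (π h) (π r) ∣ π h := EuclideanDomain.gcd_dvd_left _ _
  have hd2 : EuclideanDomain.gcd (π h) (π r) ∣ π g ^ n := by
    have : π g ^ n = π r + π h * π b := by
      simp only [hr, map_sub, map_mul, map_pow, hq]; ring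
    rw [this]
    exact dvd_add (EuclideanDomain.gcd_dvd_right _ _) (hd1.mul_right _)
  have hd3 : EuclideanDomain.gcd (π h) (π r) ∣ π g :=
    ((hsq.squarefree_of_dvd hd1).isRadical n _ hd2)
  obtain ⟨w, hw⟩ := hd3
  rw [EuclideanDomain.gcd_eq_gcd_ab] at hw
  obtain ⟨w, rfl⟩ := hπs w
  obtain ⟨x, hx⟩ := hπs (EuclideanDomain.gcdA (π h) (π r))
  obtain ⟨y, hy⟩ := hπs (EuclideanDomain.gcdB (π h) (π r))
  rw [← hx, ← hy] at hw
  have hker : C (q : ℤ) ∣ g - (h * x + r * y) * w := by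
    rw [C_dvd_iff_dvd_coeff]
    intro i
    rw [← ZMod.intCast_zmod_eq_zero_iff_dvd]
    have : π (g - (h * x + r * y) * w) = 0 := by
      simp only [map_sub, map_mul, map_add, hw, sub_self]
    rw [hπ, coe_mapRingHom] at this
    simpa only [coeff_map, eq_intCast, coeff_zero] using congrArg (fun P => P.coeff i) this
  obtain ⟨c, hc⟩ := hker
  refine ⟨aeval θ c, ⟨c, rfl⟩, aeval θ (x * w), ⟨_, rfl⟩, ?_⟩
  have := congrArg (aeval θ) hc
  simp only [map_sub, map_mul, map_add, hr0, aeval_C] at this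
  simp only [map_mul]
  have hqq : algebraMap ℤ O (q : ℤ) = q := by simp
  rw [hqq] at this
  linear_combination this

/-- Dedekind's criterion at `q` when the defining polynomial is modulo `q` a power of a
squarefree polynomial `h`. -/
theorem mem_adjoin_of_mul_mem_of_squarefree [NoZeroDivisors O] [Algebra.IsIntegral ℤ O]
    (θ : O) (q : ℕ) [Fact q.Prime] (hq0 : (q : O) ≠ 0) (h : ℤ[X])
    (hsq : Squarefree (h.map (Int.castRingHom (ZMod q)))) {s : O}
    (hs : s ∈ Algebra.adjoin ℤ {θ}) {m : ℤ} (hm : ¬ (q : ℤ) ∣ m) {e : ℕ}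
    (hue : aeval θ h ^ e = q * (m + aeval θ h * s)) {z : O}
    (hz : (q : O) * z ∈ Algebra.adjoin ℤ {θ}) : z ∈ Algebra.adjoin ℤ {θ} := by
  refine mem_of_mul_mem_of_pow_eq _ q hq0 ?_ hs ?_ hue
    (exists_eq_add_of_pow_eq_add_of_squarefree θ q h hsq) hz
  · rw [Algebra.adjoin_singleton_eq_range_aeval]
    exact ⟨h, rfl⟩
  · exact ((Nat.prime_iff_prime_int.mp Fact.out).coprime_iff_not_dvd.mpr hm).symm

/-- A subalgebra that is saturated at every prime contains every element having a nonzero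
integer multiple in it. -/
theorem mem_of_nat_mul_mem (A : Subalgebra ℤ O)
    (H : ∀ q : ℕ, q.Prime → ∀ z : O, (q : O) * z ∈ A → z ∈ A) (n : ℕ) (hn : n ≠ 0) (z : O)
    (hz : (n : O) * z ∈ A) : z ∈ A := by
  induction n using Nat.recOnMul generalizing z with
  | zero => exact absurd rfl hn
  | one => simpa using hz
  | prime q hq => exact H q hq z hz
  | mul a b ha hb =>
    refine hb (right_ne_zero_of_mul hn) z (ha (left_ne_zero_of_mul hn) _ ?_)
    rwa [← mul_assoc, ← Nat.cast_mul]

end Saturation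

/-- In `ℚ(θ)` every algebraic integer has a nonzero integer multiple in `ℤ[θ]`. -/
theorem exists_nat_mul_mem_adjoin (L : Type*) [Field L] [NumberField L]
    (θ : NumberField.RingOfIntegers L) (hgen : ℚ⟮(θ : L)⟯ = ⊤)
    (z : NumberField.RingOfIntegers L) :
    ∃ n : ℕ, n ≠ 0 ∧ (n : NumberField.RingOfIntegers L) * z ∈ Algebra.adjoin ℤ {θ} := by
  have hint : IsIntegral ℚ (θ : L) := Algebra.IsIntegral.isIntegral _
  have hz : (z : L) ∈ Algebra.adjoin ℚ {(θ : L)} := by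
    rw [← adjoin_simple_toSubalgebra_of_isAlgebraic hint.isAlgebraic, hgen]
    trivial
  rw [Algebra.adjoin_singleton_eq_range_aeval] at hz
  obtain ⟨g, hg⟩ := hz
  obtain ⟨b, hbm, hb⟩ := IsLocalization.integerNormalization_spec (nonZeroDivisors ℤ) g
  set G := IsLocalization.integerNormalization (nonZeroDivisors ℤ) g
  have hb0 : b ≠ 0 := nonZeroDivisors.ne_zero hbm
  have key : (b : NumberField.RingOfIntegers L) * z = aeval θ G := by
    apply NumberField.RingOfIntegers.coe_injective
    have h1 : algebraMap (NumberField.RingOfIntegers L) L (aeval θ G) = aeval (θ : L) G :=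
      (aeval_algebraMap_apply L θ G).symm
    have h2 : aeval (θ : L) G = aeval (θ : L) (G.map (algebraMap ℤ ℚ)) :=
      (aeval_map_algebraMap ℚ _ _).symm
    have h3 : aeval (θ : L) g = z := hg
    rw [h1, h2, hb]
    simp [h3]
  have hmem : (b : NumberField.RingOfIntegers L) * z ∈ Algebra.adjoin ℤ {θ} := by
    rw [Algebra.adjoin_singleton_eq_range_aeval, key]
    exact ⟨G, rfl⟩
  refine ⟨b.natAbs, by simpa using hb0, ?_⟩
  rcases Int.natAbs_eq b with h | h
  · rw [h] at hmem
    simpa using hmem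
  · rw [h] at hmem
    simpa using hmem

section Shanks

/-- Away from `3`, at a prime exactly dividing `k² + 3k + 9`, the Shanks polynomial is Eisenstein
around any `c` with `3c ≡ k`. -/
theorem shanks_eisenstein_of_three_mul {k q c : ℤ} (hq : Prime q) (hq3 : ¬ q ∣ 3)
    (hdvd : q ∣ k ^ 2 + 3 * k + 9) (hsq : ¬ q ^ 2 ∣ k ^ 2 + 3 * k + 9) (hc : q ∣ 3 * c - k) :
    q ∣ 3 * c ^ 2 - 2 * k * c - (k + 3) ∧
      ∃ m, ¬ q ∣ m ∧ c ^ 3 - k * c ^ 2 - (k + 3) * c - 1 = q * m := by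
  obtain ⟨a, ha⟩ := hc
  obtain ⟨b, hb⟩ := hdvd
  have h3 : IsCoprime q 3 := hq.coprime_iff_not_dvd.mpr hq3
  have h27 : IsCoprime q 27 := by
    have := h3.pow_right (n := 3)
    norm_num at this
    exact this
  have hE : 27 * (c ^ 3 - k * c ^ 2 - (k + 3) * c - 1) =
      q * (q * (q * a ^ 3 - 3 * b * a) - (2 * k + 3) * b) := by
    linear_combination ((3 * c - k) ^ 2 + (3 * c - k) * (q * a) + (q * a) ^ 2
      - 3 * (k ^ 2 + 3 * k + 9)) * ha - (3 * q * a + 2 * k + 3) * hb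
  refine ⟨h3.dvd_of_dvd_mul_left ⟨q * a ^ 2 - b, ?_⟩, ?_⟩
  · linear_combination (3 * c - k + q * a) * ha - hb
  · obtain ⟨m, hm⟩ := h27.dvd_of_dvd_mul_left ⟨_, hE⟩
    refine ⟨m, fun hqm => ?_, hm⟩
    rw [hm] at hE
    have h1 : 27 * m = q * (q * a ^ 3 - 3 * b * a) - (2 * k + 3) * b :=
      mul_left_cancel₀ hq.ne_zero (by linear_combination hE)
    have h2 : q ∣ (2 * k + 3) * b := by
      rw [show (2 * k + 3) * b = q * (q * a ^ 3 - 3 * b * a) - 27 * m by linear_combination h1]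
      exact dvd_sub (dvd_mul_right _ _) (hqm.mul_left _)
    rcases hq.dvd_or_dvd h2 with h | ⟨b', rfl⟩
    · apply hq.not_isUnit
      refine h27.isUnit_of_dvd' dvd_rfl ?_
      rw [show (27 : ℤ) = q * (4 * b) - (2 * k + 3) * (2 * k + 3) by linear_combination 4 * hb]
      exact dvd_sub (dvd_mul_right _ _) (h.mul_right _)
    · exact hsq ⟨b', by rw [hb]; ring⟩

/-- At every prime `q` dividing `k² + 3k + 9` the Shanks polynomial is Eisenstein around some `c`
and around its `q`-th power. -/
theorem exists_shanks_eisenstein {k : ℤ} (hk9 : ¬ k ≡ 3 [ZMOD 9])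
    (hD : Squarefree (if (3 : ℤ) ∣ k then (k / 3) ^ 2 + k / 3 + 1 else k ^ 2 + 3 * k + 9))
    (q : ℕ) [hq : Fact q.Prime] (hdvd : (q : ℤ) ∣ k ^ 2 + 3 * k + 9) :
    ∃ c : ℤ, ∀ c' ∈ ({c, c ^ q} : Set ℤ), (q : ℤ) ∣ 3 * c' - k ∧
      (q : ℤ) ∣ 3 * c' ^ 2 - 2 * k * c' - (k + 3) ∧
      ∃ m, ¬ (q : ℤ) ∣ m ∧ c' ^ 3 - k * c' ^ 2 - (k + 3) * c' - 1 = q * m := by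
  have hqp : Prime (q : ℤ) := Nat.prime_iff_prime_int.mp hq.out
  by_cases hq3 : q = 3
  · subst hq3
    have hk3 : (3 : ℤ) ∣ k := by
      refine Int.prime_three.dvd_of_dvd_pow (n := 2) ?_
      rw [show k ^ 2 = (k ^ 2 + 3 * k + 9) - 3 * (k + 3) by ring]
      exact dvd_sub hdvd (dvd_mul_right _ _)
    obtain ⟨m, rfl⟩ := hk3
    refine ⟨1, fun c' hc' => ?_⟩
    obtain rfl : c' = 1 := by simpa using hc'
    refine ⟨⟨1 - m, by push_cast; ring⟩, ⟨-3 * m, by push_cast; ring⟩, -(2 * m + 1), ?_,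
      by push_cast; ring⟩
    simp only [Int.ModEq] at hk9
    push_cast
    omega
  · have hq3' : ¬ (q : ℤ) ∣ 3 := by
      intro h
      exact hq3 ((Nat.prime_dvd_prime_iff_eq hq.out Nat.prime_three).mp (by exact_mod_cast h))
    have hsq : ¬ (q : ℤ) ^ 2 ∣ k ^ 2 + 3 * k + 9 := by
      intro h
      split_ifs at hD with hk3
      · obtain ⟨m, rfl⟩ := hk3
        rw [Int.mul_ediv_cancel_left _ (by norm_num)] at hD
        have h9 : IsCoprime ((q : ℤ) ^ 2) (3 ^ 2) :=
          (hqp.coprime_iff_not_dvd.mpr hq3').pow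
        rw [show (3 * m) ^ 2 + 3 * (3 * m) + 9 = 3 ^ 2 * (m ^ 2 + m + 1) by ring] at h
        have := h9.dvd_of_dvd_mul_left h
        exact hqp.not_isUnit (hD _ (by rwa [← sq]))
      · exact hqp.not_isUnit (hD _ (by rwa [← sq]))
    obtain ⟨x, y, hxy⟩ := hqp.coprime_iff_not_dvd.mpr hq3'
    have hc : (q : ℤ) ∣ 3 * (y * k) - k := ⟨-x * k, by linear_combination k * hxy⟩
    refine ⟨y * k, fun c' hc' => ?_⟩
    have hc3 : (q : ℤ) ∣ 3 * c' - k := by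
      rcases hc' with rfl | rfl
      · exact hc
      · rw [← ZMod.intCast_zmod_eq_zero_iff_dvd] at hc ⊢
        push_cast at hc ⊢
        rwa [ZMod.pow_card]
    exact ⟨hc3, shanks_eisenstein_of_three_mul hqp hq3' hdvd hsq hc3⟩

/-- `S_k(x^p)` is separable modulo every prime not dividing `p (k² + 3k + 9)`. -/
theorem separable_shanks_expand {F : Type*} [Field F] (k : F) (p : ℕ) (hp : (p : F) ≠ 0)
    (hΔ : k ^ 2 + 3 * k + 9 ≠ 0) :
    (X ^ (3 * p) - C k * X ^ (2 * p) - C (k + 3) * X ^ p - 1 : F[X]).Separable := by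
  have hp0 : p ≠ 0 := by rintro rfl; simp at hp
  set f : F[X] := X ^ (3 * p) - C k * X ^ (2 * p) - C (k + 3) * X ^ p - 1 with hf
  have hder : derivative f =
      C (p : F) * (X ^ (p - 1) * (3 * (X ^ p) ^ 2 - 2 * C k * X ^ p - C (k + 3))) := by
    obtain ⟨n, rfl⟩ : ∃ n, p = n + 1 := ⟨p - 1, by omega⟩
    simp only [hf, derivative_sub, derivative_mul, derivative_X_pow, derivative_C,
      derivative_one]
    rw [show 3 * (n + 1) - 1 = 3 * n + 2 by omega, show 2 * (n + 1) - 1 = 2 * n + 1 by omega,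
      Nat.add_sub_cancel]
    push_cast
    simp only [map_add, map_mul, map_natCast, map_ofNat, map_one]
    ring
  have h1 : IsCoprime f (C (p : F)) :=
    (isCoprime_one_right (x := f)).of_isCoprime_of_dvd_right (isUnit_C.mpr hp.isUnit).dvd
  have h2 : IsCoprime f (X ^ p) :=
    ⟨-1, (X ^ p) ^ 2 - C k * X ^ p - C (k + 3), by simp only [hf]; ring⟩
  have h3 : IsCoprime f (3 * (X ^ p) ^ 2 - 2 * C k * X ^ p - C (k + 3)) := by
    refine ⟨-C (k ^ 2 + 3 * k + 9)⁻¹ * (6 * X ^ p - 4 * C k - 3),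
      C (k ^ 2 + 3 * k + 9)⁻¹ * (2 * (X ^ p) ^ 2 - (2 * C k + 1) * X ^ p - C k - 4), ?_⟩
    have h : C (k ^ 2 + 3 * k + 9)⁻¹ * (C k ^ 2 + 3 * C k + 9) = 1 := by
      have := congrArg C (inv_mul_cancel₀ hΔ)
      simpa only [map_mul, map_add, map_pow, map_ofNat, map_one] using this
    simp only [hf, map_add, map_ofNat]
    linear_combination h
  rw [Separable, hder]
  exact h1.mul_right ((h2.of_isCoprime_of_dvd_right (pow_dvd_pow X (Nat.sub_le p 1))).mul_right h3)

variable {O : Type*} [CommRing O] [NoZeroDivisors O] [Algebra.IsIntegral ℤ O]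

/-- `ℤ[θ]` is saturated at every prime. -/
theorem shanks_mem_adjoin_of_prime_mul_mem [CharZero O] {k : ℤ} (hk9 : ¬ k ≡ 3 [ZMOD 9])
    (hD : Squarefree (if (3 : ℤ) ∣ k then (k / 3) ^ 2 + k / 3 + 1 else k ^ 2 + 3 * k + 9))
    {p : ℕ} (hp : p.Prime) (hdvd : (p : ℤ) ∣ k ^ 2 + 3 * k + 9) {θ : O}
    (hθ : θ ^ (3 * p) - (k : O) * θ ^ (2 * p) - ((k : O) + 3) * θ ^ p - 1 = 0)
    (q : ℕ) (hq : q.Prime) (z : O) (hz : (q : O) * z ∈ Algebra.adjoin ℤ {θ}) :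
    z ∈ Algebra.adjoin ℤ {θ} := by
  have : Fact q.Prime := ⟨hq⟩
  have hq0 : (q : O) ≠ 0 := Nat.cast_ne_zero.mpr hq.ne_zero
  have hmem (g : ℤ[X]) : aeval θ g ∈ Algebra.adjoin ℤ {θ} := by
    rw [Algebra.adjoin_singleton_eq_range_aeval]
    exact ⟨g, rfl⟩
  have hθA : θ ∈ Algebra.adjoin ℤ {θ} := Algebra.self_mem_adjoin_singleton ℤ θ
  by_cases hqΔ : (q : ℤ) ∣ k ^ 2 + 3 * k + 9
  · obtain ⟨c, hc⟩ := exists_shanks_eisenstein hk9 hD q hqΔ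
    have hexp (c' : ℤ) (hc' : c' ∈ ({c, c ^ q} : Set ℤ)) : ∃ m a b : ℤ, ¬ (q : ℤ) ∣ m ∧
        (θ ^ p - c') ^ 3 = q * (m + (θ ^ p - c') * (a * (θ ^ p - c') + b)) := by
      obtain ⟨⟨a, ha⟩, ⟨b, hb⟩, m, hm, hcm⟩ := hc c' hc'
      refine ⟨-m, -a, -b, by simpa using hm, ?_⟩
      have ha' := congrArg (Int.cast : ℤ → O) ha
      have hb' := congrArg (Int.cast : ℤ → O) hb
      have hcm' := congrArg (Int.cast : ℤ → O) hcm
      push_cast at ha' hb' hcm' ⊢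
      linear_combination hθ - (θ ^ p - c') ^ 2 * ha' - (θ ^ p - c') * hb' - hcm'
    by_cases hqp : q = p
    · subst hqp
      obtain ⟨m, a, b, hm, hU⟩ := hexp (c ^ q) (by simp)
      obtain ⟨s, hsA, hs⟩ : ∃ s ∈ Algebra.adjoin ℤ {θ},
          (θ - c) ^ q = θ ^ q - c ^ q + q * ((θ - c) * s) := by
        obtain ⟨r, hr⟩ := exists_add_pow_prime_eq hq (X - C c : ℤ[X]) (C c)
        have hr' := congrArg (aeval θ) hr
        simp only [map_add, map_sub, map_mul, map_pow, map_natCast, aeval_X, aeval_C,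
          sub_add_cancel, algebraMap_int_eq, Int.coe_castRingHom] at hr'
        exact ⟨-(c * aeval θ r), Subalgebra.neg_mem _ (Subalgebra.mul_mem _ (intCast_mem _ _)
          (hmem r)), by linear_combination -hr'⟩
      have he : aeval θ (X - C c : ℤ[X]) = θ - c := by simp
      have huA : θ - c ∈ Algebra.adjoin ℤ {θ} := he ▸ hmem _
      obtain ⟨t, htA, ht⟩ : ∃ t ∈ Algebra.adjoin ℤ {θ},
          θ ^ q - ((c ^ q : ℤ) : O) = (θ - c) * t := by
        refine ⟨(θ - c) ^ (q - 1) - q * s, Subalgebra.sub_mem _ (Subalgebra.pow_mem _ huA _)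
          (Subalgebra.mul_mem _ (natCast_mem _ _) hsA), ?_⟩
        rw [mul_sub, mul_pow_sub_one hq.ne_zero, hs]
        push_cast
        ring
      have hs' : (θ - c) ^ q = (θ - c) * t + q * ((θ - c) * s) := by
        rw [hs, ← ht]
        push_cast
        ring
      rw [ht] at hU
      refine mem_adjoin_of_mul_mem_of_squarefree θ q hq0 (X - C c) ?_
        (s := t * (a * ((θ - c) * t) + b) +
          (3 * (((θ - c) * t) ^ 2 * s) + (3 * (((θ - c) * t) * (q * ((θ - c) * s ^ 2))) +
            q ^ 2 * ((θ - c) ^ 2 * s ^ 3)))) ?_ hm (e := q * 3) ?_ hz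
      · simpa using (separable_X_sub_C (x := (c : ZMod q))).squarefree
      · lift t to Algebra.adjoin ℤ {θ} using htA
        lift s to Algebra.adjoin ℤ {θ} using hsA
        obtain ⟨u, hu⟩ : ∃ u : Algebra.adjoin ℤ {θ}, (u : O) = θ - c := ⟨⟨_, huA⟩, rfl⟩
        rw [← hu]
        exact (t * (a * (u * t) + b) +
          (3 * ((u * t) ^ 2 * s) + (3 * ((u * t) * (q * (u * s ^ 2))) +
            q ^ 2 * (u ^ 2 * s ^ 3)))).2
      · rw [he, pow_mul, hs']
        linear_combination hU
    · obtain ⟨m, a, b, hm, hU⟩ := hexp c (by simp)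
      have he : aeval θ (X ^ p - C c : ℤ[X]) = θ ^ p - c := by simp
      refine mem_adjoin_of_mul_mem_of_squarefree θ q hq0 (X ^ p - C c) ?_
        (s := a * (θ ^ p - c) + b) ?_ hm (e := 3) (by rw [he]; exact hU) hz
      · have hcq : ((c : ℤ) : ZMod q) ≠ 0 := by
          rw [Ne, ZMod.intCast_zmod_eq_zero_iff_dvd]
          rintro ⟨d, rfl⟩
          obtain ⟨-, -, m, -, h⟩ := hc _ (Set.mem_insert _ _)
          refine (Nat.prime_iff_prime_int.mp hq).not_isUnit (isUnit_of_dvd_one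
            ⟨(q * d) ^ 2 * d - k * (q * d) * d - (k + 3) * d - m, by linear_combination -h⟩)
        have hpq : (p : ZMod q) ≠ 0 := by
          rw [Ne, ZMod.natCast_eq_zero_iff]
          exact fun h => hqp ((Nat.prime_dvd_prime_iff_eq hq hp).mp h)
        simpa using (separable_X_pow_sub_C (c : ZMod q) hpq hcq).squarefree
      · exact Subalgebra.add_mem _ (Subalgebra.mul_mem _ (intCast_mem _ _) (Subalgebra.sub_mem _
          (Subalgebra.pow_mem _ hθA _) (intCast_mem _ _))) (intCast_mem _ _)
  · have hf : aeval θ (X ^ (3 * p) - C k * X ^ (2 * p) - C (k + 3) * X ^ p - 1 : ℤ[X]) = 0 := by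
      simpa [map_ofNat] using hθ
    have hΔ : (k : ZMod q) ^ 2 + 3 * k + 9 ≠ 0 := by
      rw [← ZMod.intCast_zmod_eq_zero_iff_dvd] at hqΔ
      exact_mod_cast hqΔ
    have hpq : (p : ZMod q) ≠ 0 := by
      rw [Ne, ZMod.natCast_eq_zero_iff]
      exact fun h => hqΔ ((Int.natCast_dvd_natCast.mpr h).trans hdvd)
    refine mem_adjoin_of_mul_mem_of_squarefree θ q hq0
      (X ^ (3 * p) - C k * X ^ (2 * p) - C (k + 3) * X ^ p - 1 + C (q : ℤ)) ?_
      (Subalgebra.zero_mem _) (m := 1) ?_ (e := 1) ?_ hz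
    · simpa [map_ofNat] using (separable_shanks_expand (k : ZMod q) p hpq hΔ).squarefree
    · exact fun h => (Nat.prime_iff_prime_int.mp hq).not_isUnit (isUnit_of_dvd_one h)
    · rw [map_add, hf]
      simp

end Shanks

/-- Let `k ≥ 1` with `k ≢ 3 (mod 9)` be such that `D` is
squarefree, and let `p` be a prime dividing `k² + 3k + 9`.  Then `S_k(x^p)` is
monogenic: if `θ` is a root of `S_k(x^p)` and `L = ℚ(θ)`, then `ℤ[θ]` equals
the ring of integers of `L`. -/
theorem shanks_power_monogenic (k : ℤ) (hk : 1 ≤ k) (hk9 : ¬ k ≡ 3 [ZMOD 9])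
    (hD : Squarefree (if (3 : ℤ) ∣ k then (k / 3) ^ 2 + k / 3 + 1 else k ^ 2 + 3 * k + 9))
    (p : ℕ) (hp : p.Prime) (hdvd : (p : ℤ) ∣ k ^ 2 + 3 * k + 9)
    (L : Type*) [Field L] [NumberField L] (θ : NumberField.RingOfIntegers L)
    (hθ : θ ^ (3 * p) - (k : NumberField.RingOfIntegers L) * θ ^ (2 * p)
      - ((k : NumberField.RingOfIntegers L) + 3) * θ ^ p - 1 = 0)
    (hgen : ℚ⟮(θ : L)⟯ = ⊤) :
    Algebra.adjoin ℤ ({θ} : Set (NumberField.RingOfIntegers L)) = ⊤ := by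
  refine eq_top_iff.mpr fun z _ => ?_
  obtain ⟨n, hn, hz⟩ := exists_nat_mul_mem_adjoin L θ hgen z
  exact mem_of_nat_mul_mem _ (shanks_mem_adjoin_of_prime_mul_mem hk9 hD hp hdvd hθ) n hn z hz
end

section
/- Let k ≥ 1 be an integer with k ≢ 3 (mod 9) such that D is squarefree, and let p be a prime. Let θ be a root of the irreducible polynomial S_k(x^p), let L = ℚ(θ), and let Z_L be the ring of integers of L. Then S_k(x^p) is monogenic (i.e. ℤ[θ] = Z_L) if and only if p does not divide the index [Z_L : ℤ[θ]]. -/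
open Polynomial IntermediateField

/-- A ring of characteristic dividing a prime `ℓ`, generated by an element of finite order prime
to `ℓ`, is fixed by a power of Frobenius. -/
theorem exists_forall_pow_prime_pow_eq {A : Type*} [CommRing A] {ℓ N : ℕ} (hℓ : ℓ.Prime)
    (h0 : (ℓ : A) = 0) {t : A} (ht : t ^ N = 1) (hN : ℓ.Coprime N)
    (hgen : ∀ y : A, ∃ P : ℤ[X], aeval t P = y) :
    ∃ m, m ≠ 0 ∧ ∀ y : A, y ^ ℓ ^ m = y := by
  have hN0 : 0 < N := by
    rcases Nat.eq_zero_or_pos N with rfl | h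
    · exact absurd (Nat.coprime_zero_right ℓ |>.1 hN) hℓ.one_lt.ne'
    · exact h
  refine ⟨N.totient, (Nat.totient_pos.2 hN0).ne', fun y ↦ ?_⟩
  have htN : t ^ ℓ ^ N.totient = t := by
    have h1 : 1 ≤ ℓ ^ N.totient := Nat.one_le_pow _ _ hℓ.pos
    obtain ⟨c, hc⟩ := (Nat.modEq_iff_dvd' h1).1 (Nat.ModEq.pow_totient hN).symm
    rw [show ℓ ^ N.totient = N * c + 1 by omega, pow_add, pow_mul, ht, one_pow, one_mul, pow_one]
  have hint (c : ℤ) : ((c : A)) ^ ℓ ^ N.totient = c := by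
    have := Fact.mk hℓ
    have h : ((c ^ ℓ ^ N.totient - c : ℤ) : ZMod ℓ) = 0 := by
      push_cast
      rw [ZMod.pow_card_pow, sub_self]
    obtain ⟨d, hd⟩ := (ZMod.intCast_zmod_eq_zero_iff_dvd _ ℓ).1 h
    have h' := congrArg (Int.cast : ℤ → A) hd
    push_cast at h'
    rw [h0, zero_mul] at h'
    exact sub_eq_zero.1 h'
  obtain ⟨P, rfl⟩ := hgen y
  induction P using Polynomial.induction_on' with
  | add P Q hP hQ =>
    obtain ⟨r, hr⟩ := exists_add_pow_prime_pow_eq hℓ (aeval t P) (aeval t Q) N.totient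
    rw [map_add, hr, hP, hQ, h0]
    ring
  | monomial n c =>
    rw [aeval_monomial, mul_pow, ← pow_mul, mul_comm n, pow_mul, htN]
    congr 1
    simpa using hint c

theorem isReduced_of_forall_pow_eq {A : Type*} [CommRing A] {q : ℕ} (hq : 2 ≤ q)
    (h : ∀ y : A, y ^ q = y) : IsReduced A := by
  refine ⟨fun y ⟨n, hn⟩ ↦ ?_⟩
  have hy (j : ℕ) : y ^ q ^ j = y := by
    induction j with
    | zero => simp
    | succ j ih => rw [pow_succ, pow_mul, ih, h]
  rw [← hy n]
  exact pow_eq_zero_of_le (Nat.lt_pow_self hq).le hn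

/-- If `ℤ[θ] / (γ, ℓ)` is reduced and `ℓ` lies in `γ ℤ[θ]` up to an integer prime to `ℓ`,
then an element of the integral closure multiplied into `ℤ[θ]` by `ℓ` and `γ` lies in `ℤ[θ]`. -/
theorem mem_of_isReduced_quotient {O : Type*} [CommRing O] [IsDomain O]
    [Algebra.IsIntegral ℤ O] {R : Subalgebra ℤ O} {ℓ : ℕ} (hℓ : ℓ.Prime) {γ : R} (hγ : γ ≠ 0)
    {d : ℤ} (hd : ¬ (ℓ : ℤ) ∣ d) (hdγ : γ ∣ (d * ℓ : R))
    [IsReduced (R ⧸ Ideal.span {γ, (ℓ : R)})] {x : O}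
    (hℓx : (ℓ : O) * x ∈ R) (hγx : (γ : O) * x ∈ R) : x ∈ R := by
  obtain ⟨P, hP, hPx⟩ := Algebra.IsIntegral.isIntegral (R := ℤ) x
  have hy : γ ∣ (⟨γ * x, hγx⟩ : R) ^ (P.map (algebraMap ℤ R)).natDegree := by
    refine dvd_pow_natDegree_of_eval₂_eq_zero (f := algebraMap R O) (z := x)
      Subtype.val_injective (hP.map _) _ _ ?_ rfl
    rw [eval₂_map, ← IsScalarTower.algebraMap_eq]
    exact hPx
  have hrad : (Ideal.span {γ, (ℓ : R)}).IsRadical :=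
    (Ideal.isRadical_iff_quotient_reduced _).2 inferInstance
  have hmem : (⟨γ * x, hγx⟩ : R) ∈ Ideal.span {γ, (ℓ : R)} :=
    hrad ⟨_, Ideal.mem_of_dvd _ hy (Ideal.subset_span (by simp))⟩
  obtain ⟨a, b, hab⟩ := Ideal.mem_span_pair.1 hmem
  obtain ⟨c, hc⟩ := hdγ
  have hdx : (d : O) * x ∈ R := by
    have h1 : (a : O) * γ + b * ℓ = γ * x := by simpa using congrArg (Subtype.val) hab
    have h2 : (d : O) * ℓ = γ * c := by simpa using congrArg (Subtype.val) hc
    have h3 : (d : O) * x = d * a + b * c := by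
      refine mul_left_cancel₀ (a := (γ : O)) (by simpa using hγ) ?_
      linear_combination (-(d : O)) * h1 + b * h2
    rw [h3]
    exact (d * a + b * c : R).2
  obtain ⟨u, v, huv⟩ := ((Nat.prime_iff_prime_int.1 hℓ).coprime_iff_not_dvd.2 hd)
  have h4 : x = u * (ℓ * x) + v * (d * x) := by
    have := congrArg (Int.cast : ℤ → O) huv
    push_cast at this
    linear_combination (-x) * this
  rw [h4]
  exact add_mem (mul_mem (intCast_mem R u) hℓx) (mul_mem (intCast_mem R v) hdx)

/-- Local maximality of `ℤ[θ]` at a prime `ℓ` modulo which the cubic satisfied by `θ ^ p` is a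
cube, with an Eisenstein translate. -/
theorem mem_adjoin_of_eisenstein_cubic_pow {O : Type*} [CommRing O] [IsDomain O] [CharZero O]
    [Algebra.IsIntegral ℤ O] {θ : O} {p ℓ : ℕ} (hℓ : ℓ.Prime) (hp : ℓ.Coprime p) {a b c d : ℤ}
    (ha : ¬ (ℓ : ℤ) ∣ a) (hd : ¬ (ℓ : ℤ) ∣ d)
    (hθ : (θ ^ p - a) ^ 3 + ℓ * (b * (θ ^ p - a) ^ 2 + c * (θ ^ p - a) + d) = 0)
    {x : O} (hx : (ℓ : O) * x ∈ Algebra.adjoin ℤ {θ}) : x ∈ Algebra.adjoin ℤ {θ} := by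
  set R := Algebra.adjoin ℤ {θ} with hR
  let t : R := ⟨θ, Algebra.self_mem_adjoin_singleton ℤ θ⟩
  set γ : R := t ^ p - a with hγdef
  have hγO : (γ : O) = θ ^ p - a := by simp [hγdef, t]
  have hγeq : γ ^ 3 + ℓ * (b * γ ^ 2 + c * γ + d) = 0 := by
    apply Subtype.val_injective
    simpa [hγO] using hθ
  have hd0 : d ≠ 0 := by rintro rfl; simp at hd
  have hγ0 : γ ≠ 0 := by
    intro h
    rw [h] at hγeq
    have h' : (d : R) = 0 ∨ (ℓ : R) = 0 := by simpa [or_comm] using hγeq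
    have h'' : (d : O) = 0 ∨ (ℓ : O) = 0 :=
      h'.imp (fun h ↦ by simpa using congrArg Subtype.val h)
        (fun h ↦ by simpa using congrArg Subtype.val h)
    simp [hd0, hℓ.ne_zero] at h''
  have hdvd : γ ∣ (d * ℓ : R) := ⟨-(γ ^ 2 + ℓ * (b * γ + c)), by linear_combination hγeq⟩
  have hred : IsReduced (R ⧸ Ideal.span {γ, (ℓ : R)}) := by
    set I := Ideal.span {γ, (ℓ : R)} with hI
    have hℓ0 : (ℓ : R ⧸ I) = 0 := by
      rw [← map_natCast (Ideal.Quotient.mk I)]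
      exact Ideal.Quotient.eq_zero_iff_mem.2 (Ideal.subset_span (by simp))
    have htp : (Ideal.Quotient.mk I t) ^ p = a := by
      rw [← sub_eq_zero, ← map_intCast (Ideal.Quotient.mk I), ← map_pow, ← map_sub]
      exact Ideal.Quotient.eq_zero_iff_mem.2 (Ideal.subset_span (by simp [hγdef]))
    have hapow : (a : R ⧸ I) ^ (ℓ - 1) = 1 := by
      obtain ⟨e, he⟩ := (Int.ModEq.pow_card_sub_one_eq_one hℓ
        ((Nat.prime_iff_prime_int.1 hℓ).coprime_iff_not_dvd.2 ha).symm).symm.dvd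
      have h' := congrArg (Int.cast : ℤ → R ⧸ I) he
      push_cast at h'
      rw [hℓ0, zero_mul] at h'
      exact sub_eq_zero.1 h'
    obtain ⟨m, hm, h⟩ := exists_forall_pow_prime_pow_eq (N := p * (ℓ - 1)) hℓ hℓ0
      (by rw [pow_mul, htp, hapow]) (hp.mul_right ((Nat.coprime_self_sub_right hℓ.one_le).2 (by simp)))
      (fun y ↦ by
        obtain ⟨⟨y, hy⟩, rfl⟩ := Ideal.Quotient.mk_surjective y
        obtain ⟨P, hP : aeval θ P = y⟩ := by
          rwa [hR, Algebra.adjoin_singleton_eq_range_aeval, AlgHom.mem_range] at hy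
        refine ⟨P, ?_⟩
        have h1 : aeval t P = ⟨y, hy⟩ := Subtype.val_injective (by
          exact (aeval_algHom_apply R.val t P).symm.trans hP)
        rw [← h1]
        exact aeval_algHom_apply (Ideal.Quotient.mkₐ ℤ I) t P)
    exact isReduced_of_forall_pow_eq (hℓ.two_le.trans (Nat.le_self_pow hm ℓ)) h
  have step {z : O} (hz : (ℓ : O) * z ∈ R) (h : (γ : O) * z ∈ R) : z ∈ R :=
    mem_of_isReduced_quotient hℓ hγ0 hd hdvd hz h
  have hcube : (γ : O) * (γ * (γ * x)) ∈ R := by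
    have : (γ : O) * (γ * (γ * x)) = -((b * γ ^ 2 + c * γ + d : R) : O) * (ℓ * x) := by
      have h := congrArg Subtype.val hγeq
      push_cast at h ⊢
      linear_combination x * h
    rw [this]
    exact mul_mem (neg_mem (SetLike.coe_mem _)) hx
  have hmul {z : O} (hz : (ℓ : O) * z ∈ R) : (ℓ : O) * (γ * z) ∈ R := by
    rw [mul_left_comm]
    exact mul_mem γ.2 hz
  exact step hx (step (hmul hx) (step (hmul (hmul hx)) hcube))

/-- The Shanks cubic has an Eisenstein translate at every prime dividing its discriminant. -/
theorem exists_eisenstein_translate_shanks {k : ℤ} (hk9 : ¬ k ≡ 3 [ZMOD 9])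
    (hD : Squarefree (if (3 : ℤ) ∣ k then (k / 3) ^ 2 + k / 3 + 1 else k ^ 2 + 3 * k + 9))
    {ℓ : ℤ} (hℓ : Prime ℓ) (hdvd : ℓ ∣ k ^ 2 + 3 * k + 9) :
    ∃ a b c d : ℤ, 3 * a - k = ℓ * b ∧ 3 * a ^ 2 - 2 * k * a - (k + 3) = ℓ * c ∧
      a ^ 3 - k * a ^ 2 - (k + 3) * a - 1 = ℓ * d ∧ ¬ ℓ ∣ d := by
  by_cases h3 : ℓ ∣ 3
  · have hass : Associated ℓ 3 := hℓ.associated_of_dvd Int.prime_three h3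
    have hk3 : (3 : ℤ) ∣ k := by
      have h := hass.dvd_iff_dvd_left.1 hdvd
      have : (3 : ℤ) ∣ k ^ 2 := by omega
      exact Int.prime_three.dvd_of_dvd_pow this
    obtain ⟨m, rfl⟩ := hk3
    obtain ⟨b, hb⟩ : ℓ ∣ 3 - 3 * m := h3.trans ⟨1 - m, by ring⟩
    obtain ⟨c, hc⟩ : ℓ ∣ -(9 * m) := h3.trans ⟨-(3 * m), by ring⟩
    obtain ⟨d, hd⟩ : ℓ ∣ -(6 * m + 3) := h3.trans ⟨-(2 * m + 1), by ring⟩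
    refine ⟨1, b, c, d, by linarith, by linarith, by linarith, fun h ↦ hk9 ?_⟩
    have h9 : (3 : ℤ) * 3 ∣ -(6 * m + 3) := by
      rw [hd]
      exact mul_dvd_mul hass.symm.dvd (hass.symm.dvd.trans h)
    rw [Int.modEq_iff_dvd]
    omega
  · have hsq : ¬ ℓ * ℓ ∣ k ^ 2 + 3 * k + 9 := by
      intro h
      refine hℓ.not_isUnit (hD ℓ ?_)
      split_ifs with hk3
      · obtain ⟨m, rfl⟩ := hk3
        have hcop : IsCoprime (ℓ * ℓ) 9 := by
          have : IsCoprime ℓ 3 := hℓ.coprime_iff_not_dvd.2 h3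
          rw [show (9 : ℤ) = 3 * 3 by norm_num]
          exact (this.mul_right this).mul_left (this.mul_right this)
        refine hcop.dvd_of_dvd_mul_left (h.trans (dvd_of_eq ?_))
        rw [Int.mul_ediv_cancel_left _ (by norm_num)]
        ring
      · exact h
    have hcop : IsCoprime ℓ 3 := hℓ.coprime_iff_not_dvd.2 h3
    have hcop27 : IsCoprime ℓ 27 := by
      rw [show (27 : ℤ) = 3 ^ 3 by norm_num]
      exact hcop.pow_right
    obtain ⟨e, he⟩ := hdvd
    have he' : ¬ ℓ ∣ e := fun h ↦ hsq (he ▸ mul_dvd_mul_left ℓ h)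
    obtain ⟨u, v, huv⟩ := hcop
    have hs : 3 * (k * v) - k = ℓ * (-(k * u)) := by linear_combination k * huv
    generalize k * v = a at hs
    generalize -(k * u) = s at hs
    obtain ⟨c, hc⟩ : ℓ ∣ 3 * a ^ 2 - 2 * k * a - (k + 3) := by
      refine (hℓ.coprime_iff_not_dvd.2 h3).dvd_of_dvd_mul_left ⟨ℓ * s ^ 2 - e, ?_⟩
      linear_combination (3 * a - k + ℓ * s) * hs - he
    have key : 27 * (a ^ 3 - k * a ^ 2 - (k + 3) * a - 1) =
        ℓ * (ℓ ^ 2 * s ^ 3 - 3 * ℓ * e * s - (2 * k + 3) * e) := by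
      linear_combination ((3 * a - k) ^ 2 + (3 * a - k) * ℓ * s + ℓ ^ 2 * s ^ 2 - 3 * ℓ * e) * hs
        - (3 * (3 * a - k) + (2 * k + 3)) * he
    obtain ⟨d, hd⟩ : ℓ ∣ a ^ 3 - k * a ^ 2 - (k + 3) * a - 1 :=
      hcop27.dvd_of_dvd_mul_left ⟨_, key⟩
    refine ⟨a, s, c, d, hs, hc, hd, ?_⟩
    rintro ⟨f, rfl⟩
    have h1 : ℓ ∣ (2 * k + 3) * e := by
      refine ⟨ℓ * s ^ 3 - 3 * e * s - 27 * f, mul_left_cancel₀ hℓ.ne_zero ?_⟩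
      linear_combination key - 27 * hd
    obtain ⟨g, hg⟩ := (hℓ.dvd_or_dvd h1).resolve_right he'
    have h27 : ℓ ∣ 27 := ⟨4 * e - (2 * k + 3) * g, by linear_combination 4 * he - (2 * k + 3) * hg⟩
    exact hℓ.not_isUnit (hcop27.isUnit_of_dvd' dvd_rfl h27)

/-- The value at `θ` of the derivative of any integral polynomial vanishing at a generator `θ`
multiplies the ring of integers into `ℤ[θ]`. -/
theorem aeval_derivative_mul_mem_adjoin {L : Type*} [Field L] [NumberField L]
    {θ : NumberField.RingOfIntegers L} (hgen : ℚ⟮(θ : L)⟯ = ⊤) {F : ℤ[X]} (hF : aeval θ F = 0)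
    (x : NumberField.RingOfIntegers L) :
    aeval θ (derivative F) * x ∈ Algebra.adjoin ℤ {θ} := by
  have hgen' : Algebra.adjoin ℚ {algebraMap (NumberField.RingOfIntegers L) L θ} = ⊤ := by
    rw [← IntermediateField.adjoin_simple_toSubalgebra_of_isAlgebraic
      (Algebra.IsAlgebraic.isAlgebraic (R := ℚ) (θ : L)), hgen, IntermediateField.top_toSubalgebra]
  have hcond : aeval θ (derivative (minpoly ℤ θ)) ∈ conductor ℤ θ :=
    Ideal.mul_le_right (I := differentIdeal ℤ (NumberField.RingOfIntegers L))
      (by rw [mul_comm, conductor_mul_differentIdeal ℤ ℚ L θ hgen']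
          exact Ideal.mem_span_singleton_self _)
  obtain ⟨G, rfl⟩ := minpoly.isIntegrallyClosed_dvd (Algebra.IsIntegral.isIntegral θ) hF
  have h : aeval θ (derivative (minpoly ℤ θ * G)) * x =
      aeval θ (derivative (minpoly ℤ θ)) * x * aeval θ G := by
    simp only [derivative_mul, map_add, map_mul, minpoly.aeval]
    ring
  rw [h]
  exact mul_mem (mem_conductor_iff.1 hcond x) (aeval_mem_adjoin_singleton ℤ θ)

theorem discr_mul_mem_adjoin_of_shanks_pow {L : Type*} [Field L] [NumberField L] {k : ℤ} {p : ℕ}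
    (hp : p ≠ 0) {θ : NumberField.RingOfIntegers L}
    (hθ : (θ ^ p) ^ 3 - k * (θ ^ p) ^ 2 - (k + 3) * θ ^ p - 1 = 0)
    (hgen : ℚ⟮(θ : L)⟯ = ⊤) (x : NumberField.RingOfIntegers L) :
    ((p * (k ^ 2 + 3 * k + 9) : ℤ) : NumberField.RingOfIntegers L) * x ∈
      Algebra.adjoin ℤ {θ} := by
  have h := aeval_derivative_mul_mem_adjoin hgen
    (F := (X ^ 3 - C k * X ^ 2 - C (k + 3) * X - 1 : ℤ[X]).comp (X ^ p))
    (by simpa [aeval_comp, map_ofNat] using hθ) x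
  have ht : θ ∈ Algebra.adjoin ℤ {θ} := Algebra.self_mem_adjoin_singleton ℤ θ
  have hz (n : ℤ) : (n : NumberField.RingOfIntegers L) ∈ Algebra.adjoin ℤ {θ} :=
    intCast_mem _ n
  have hder : θ * aeval θ (derivative
      ((X ^ 3 - C k * X ^ 2 - C (k + 3) * X - 1 : ℤ[X]).comp (X ^ p))) =
      p * θ ^ p * (3 * (θ ^ p) ^ 2 - 2 * k * θ ^ p - (k + 3)) := by
    rw [derivative_comp, map_mul, aeval_comp]
    simp only [derivative_mul, derivative_X_pow, derivative_C, derivative_X,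
      derivative_one, map_sub, map_mul, map_add, map_pow, aeval_X, aeval_C, map_natCast, map_zero,
      map_one]
    obtain ⟨q, rfl⟩ := Nat.exists_eq_succ_of_ne_zero hp
    simp
    ring
  have hmem := mul_mem (mul_mem ht h) (Subalgebra.sub_mem _ (Subalgebra.sub_mem _
    (mul_mem (hz 2) (pow_mem (pow_mem ht p) 2)) (mul_mem (hz (2 * k + 1)) (pow_mem ht p)))
    (hz (k + 4)))
  have hmem' := mul_mem hmem (Subalgebra.sub_mem _ (Subalgebra.sub_mem _ (pow_mem (pow_mem ht p) 2)
    (mul_mem (hz k) (pow_mem ht p))) (hz (k + 3)))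
  convert hmem' using 1
  rw [← mul_assoc θ, hder]
  push_cast
  generalize θ ^ p = α at hθ
  have h1 : (3 * α ^ 2 - 2 * k * α - (k + 3)) * (2 * α ^ 2 - (2 * k + 1) * α - (k + 4)) =
      (k : NumberField.RingOfIntegers L) ^ 2 + 3 * k + 9 := by
    linear_combination (6 * α - 4 * k - 3) * hθ
  have h2 : α * (α ^ 2 - k * α - (k + 3)) = 1 := by linear_combination hθ
  rw [← h1]
  linear_combination (-(p : NumberField.RingOfIntegers L) * x *
    ((3 * α ^ 2 - 2 * k * α - (k + 3)) * (2 * α ^ 2 - (2 * k + 1) * α - (k + 4)))) * h2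

theorem mem_adjoin_of_prime_mul_mem_of_shanks_pow {L : Type*} [Field L] [NumberField L] {k : ℤ}
    (hk9 : ¬ k ≡ 3 [ZMOD 9])
    (hD : Squarefree (if (3 : ℤ) ∣ k then (k / 3) ^ 2 + k / 3 + 1 else k ^ 2 + 3 * k + 9))
    {p : ℕ} (hp : p.Prime) {θ : NumberField.RingOfIntegers L}
    (hθ : (θ ^ p) ^ 3 - k * (θ ^ p) ^ 2 - (k + 3) * θ ^ p - 1 = 0)
    (hgen : ℚ⟮(θ : L)⟯ = ⊤) {ℓ : ℕ} (hℓ : ℓ.Prime) (hne : ℓ ≠ p)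
    {x : NumberField.RingOfIntegers L}
    (hx : (ℓ : NumberField.RingOfIntegers L) * x ∈ Algebra.adjoin ℤ {θ}) :
    x ∈ Algebra.adjoin ℤ {θ} := by
  have hℓ' : Prime (ℓ : ℤ) := Nat.prime_iff_prime_int.1 hℓ
  have hcop : ℓ.Coprime p := (Nat.coprime_primes hℓ hp).2 hne
  by_cases hdvd : (ℓ : ℤ) ∣ k ^ 2 + 3 * k + 9
  · obtain ⟨a, b, c, d, hb, hc, hd, hnd⟩ := exists_eisenstein_translate_shanks hk9 hD hℓ' hdvd
    refine mem_adjoin_of_eisenstein_cubic_pow (a := a) (b := b) (c := c) (d := d) hℓ hcop ?_ hnd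
      ?_ hx
    · intro h
      refine hℓ'.not_dvd_one ?_
      have h1 : (1 : ℤ) = a * (a ^ 2 - k * a - (k + 3)) - ℓ * d := by linear_combination -hd
      rw [h1]
      exact dvd_sub (h.mul_right _) (dvd_mul_right _ _)
    · have hb' := congrArg (Int.cast : ℤ → NumberField.RingOfIntegers L) hb
      have hc' := congrArg (Int.cast : ℤ → NumberField.RingOfIntegers L) hc
      have hd' := congrArg (Int.cast : ℤ → NumberField.RingOfIntegers L) hd
      push_cast at hb' hc' hd'
      linear_combination hθ - (θ ^ p - a) ^ 2 * hb' - (θ ^ p - a) * hc' - hd'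
  · have hndvd : ¬ (ℓ : ℤ) ∣ p * (k ^ 2 + 3 * k + 9) := fun h ↦
      (hℓ'.dvd_or_dvd h).elim
        (fun h ↦ hne ((Nat.prime_dvd_prime_iff_eq hℓ hp).1 (Int.natCast_dvd_natCast.1 h))) hdvd
    obtain ⟨u, v, huv⟩ := hℓ'.coprime_iff_not_dvd.2 hndvd
    have h := discr_mul_mem_adjoin_of_shanks_pow hp.ne_zero hθ hgen x
    have hx' : x = u * (ℓ * x) +
        v * (((p * (k ^ 2 + 3 * k + 9) : ℤ) : NumberField.RingOfIntegers L) * x) := by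
      have := congrArg (Int.cast : ℤ → NumberField.RingOfIntegers L) huv
      rw [Int.cast_add, Int.cast_mul, Int.cast_mul, Int.cast_one, Int.cast_natCast] at this
      linear_combination (-x) * this
    rw [hx']
    exact add_mem (mul_mem (intCast_mem _ u) hx) (mul_mem (intCast_mem _ v) h)

/-- Let `k ≥ 1` with `k ≢ 3 (mod 9)` be such that `D` is
squarefree, and let `p` be a prime.  Let `θ` be a root of the irreducible
polynomial `S_k(x^p)`, `L = ℚ(θ)` and `Z_L` the ring of integers of `L`.  Then
`S_k(x^p)` is monogenic (i.e. `ℤ[θ] = Z_L`) if and only if `p` does not divide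
the index `[Z_L : ℤ[θ]]`. -/
theorem shanks_power_monogenic_iff_index (k : ℤ) (hk : 1 ≤ k) (hk9 : ¬ k ≡ 3 [ZMOD 9])
    (hD : Squarefree (if (3 : ℤ) ∣ k then (k / 3) ^ 2 + k / 3 + 1 else k ^ 2 + 3 * k + 9))
    (p : ℕ) (hp : p.Prime)
    (L : Type*) [Field L] [NumberField L] (θ : NumberField.RingOfIntegers L)
    (hθ : θ ^ (3 * p) - (k : NumberField.RingOfIntegers L) * θ ^ (2 * p)
      - ((k : NumberField.RingOfIntegers L) + 3) * θ ^ p - 1 = 0)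
    (hgen : ℚ⟮(θ : L)⟯ = ⊤) :
    Algebra.adjoin ℤ ({θ} : Set (NumberField.RingOfIntegers L)) = ⊤ ↔
      ¬ (p : ℕ) ∣ (Algebra.adjoin ℤ
        ({θ} : Set (NumberField.RingOfIntegers L))).toSubring.toAddSubgroup.index := by
  have hθ' : (θ ^ p) ^ 3 - k * (θ ^ p) ^ 2 - (k + 3) * θ ^ p - 1 = 0 := by
    rw [← hθ, ← pow_mul, ← pow_mul, mul_comm p 3, mul_comm p 2]
  constructor
  · intro h
    have h1 : (Algebra.adjoin ℤ
        ({θ} : Set (NumberField.RingOfIntegers L))).toSubring.toAddSubgroup.index = 1 := by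
      rw [AddSubgroup.index_eq_one, h]
      rfl
    rw [h1]
    exact hp.not_dvd_one
  · intro h
    have key (n : ℕ) (hn : ¬ p ∣ n) (x : NumberField.RingOfIntegers L)
        (hx : (n : NumberField.RingOfIntegers L) * x ∈ Algebra.adjoin ℤ {θ}) :
        x ∈ Algebra.adjoin ℤ {θ} := by
      induction n using induction_on_primes with
      | zero => exact absurd (dvd_zero p) hn
      | one => simpa using hx
      | prime_mul ℓ n hℓ ih =>
        refine ih (fun h ↦ hn (h.mul_left ℓ)) ?_
        refine mem_adjoin_of_prime_mul_mem_of_shanks_pow hk9 hD hp hθ' hgen hℓ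
          (fun h ↦ hn (h ▸ dvd_mul_right ℓ n)) ?_
        rwa [← mul_assoc, ← Nat.cast_mul]
    refine eq_top_iff.2 fun x _ ↦ key _ h x ?_
    rw [← nsmul_eq_mul]
    exact AddSubgroup.nsmul_index_mem (Algebra.adjoin ℤ
      ({θ} : Set (NumberField.RingOfIntegers L))).toSubring.toAddSubgroup x
end

section
/- Let k ≥ 1 be an integer and let q > 3 be a prime dividing k² + 3k + 9. Then q does not divide k, 3 is invertible modulo q, and in 𝔽_q[x] the reduction of S_k(x) modulo q is the perfect cube (x − α)³, where α = k·3⁻¹ in 𝔽_q. -/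
open Polynomial

/-- Let `k ≥ 1` and let `q > 3` be a prime dividing
`k² + 3k + 9`.  Then `q ∤ k`, `3` is invertible modulo `q`, and in `𝔽_q[x]` the
reduction of the Shanks polynomial `S_k(x) = x³ − k·x² − (k+3)·x − 1` modulo
`q` is the perfect cube `(x − α)³`, where `α = k·3⁻¹` in `𝔽_q`. -/
theorem shanks_mod_q_cube (k : ℤ) (hk : 1 ≤ k) (q : ℕ) (hq : q.Prime) (hq3 : 3 < q)
    (hdvd : (q : ℤ) ∣ k ^ 2 + 3 * k + 9) :
    ¬ (q : ℤ) ∣ k ∧ IsUnit (3 : ZMod q) ∧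
      X ^ 3 - C (k : ZMod q) * X ^ 2 - C ((k : ZMod q) + 3) * X - 1 =
        (X - C ((k : ZMod q) * (3 : ZMod q)⁻¹)) ^ 3 := by
  have : Fact q.Prime := ⟨hq⟩
  have h3 : (3 : ZMod q) ≠ 0 := by
    intro h
    have h' : ((3 : ℕ) : ZMod q) = 0 := by exact_mod_cast h
    rw [ZMod.natCast_eq_zero_iff] at h'
    exact absurd (Nat.le_of_dvd (by norm_num) h') (by omega)
  have hroot : (k : ZMod q) ^ 2 + 3 * k + 9 = 0 := by
    have h := (ZMod.intCast_zmod_eq_zero_iff_dvd _ q).2 hdvd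
    push_cast at h
    exact h
  refine ⟨fun h => ?_, h3.isUnit, ?_⟩
  · have hk0 : (k : ZMod q) = 0 := (ZMod.intCast_zmod_eq_zero_iff_dvd k q).2 h
    rw [hk0] at hroot
    exact pow_ne_zero 2 h3 (by linear_combination hroot)
  · obtain ⟨a, ha⟩ : ∃ a : ZMod q, (k : ZMod q) = 3 * a :=
      ⟨3⁻¹ * k, (mul_inv_cancel_left₀ h3 _).symm⟩
    have haa : a ^ 2 + a + 1 = 0 := by
      rw [ha] at hroot
      refine (mul_eq_zero.1 ?_).resolve_left (pow_ne_zero 2 h3)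
      linear_combination hroot
    have hC : (C a : (ZMod q)[X]) ^ 2 + C a + 1 = 0 := by
      simpa using congrArg (C : ZMod q → (ZMod q)[X]) haa
    have hC3 : (C (3 : ZMod q) : (ZMod q)[X]) = 3 := map_ofNat C 3
    rw [ha, mul_comm 3 a, mul_inv_cancel_right₀ h3]
    simp only [C_add, C_mul, hC3]
    linear_combination (C a - 1 - 3 * X) * hC
end

section
/- Let k ≥ 1 be an integer with k ≢ 3 (mod 9) such that D is squarefree, and let p > 3 be a prime dividing k² + 3k + 9. Let α = −(k+3)·k⁻¹ in ℤ/p²ℤ (note k is invertible modulo p²). Then S_k(α^p) ≠ 0 in ℤ/p²ℤ; that is, α^{3p} − k·α^{2p} − (k+3)·α^p − 1 is a nonzero element of ℤ/p²ℤ. -/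
/-- If `D` is squarefree, the square of a prime not dividing `3` cannot divide `k² + 3k + 9`. -/
theorem not_sq_dvd_of_squarefree {k q : ℤ} (hq : Prime q) (hq3 : ¬ q ∣ 3)
    (hD : Squarefree (if (3 : ℤ) ∣ k then (k / 3) ^ 2 + k / 3 + 1 else k ^ 2 + 3 * k + 9)) :
    ¬ q ^ 2 ∣ k ^ 2 + 3 * k + 9 := by
  intro h
  refine hq.not_isUnit (hD q ?_)
  rw [← pow_two]
  split_ifs with h3
  · obtain ⟨m, rfl⟩ := h3
    rw [Int.mul_ediv_cancel_left _ (by norm_num)]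
    have hcop : IsCoprime (q ^ 2) ((3 : ℤ) ^ 2) := ((hq.coprime_iff_not_dvd).2 hq3).pow
    refine hcop.dvd_of_dvd_mul_left ?_
    rwa [show (3 * m) ^ 2 + 3 * (3 * m) + 9 = 3 ^ 2 * (m ^ 2 + m + 1) by ring] at h
  · exact h

/-- Let `k ≥ 1` with `k ≢ 3 (mod 9)` be such that `D` is
squarefree, and let `p > 3` be a prime dividing `k² + 3k + 9`.  Let
`α = −(k+3)·k⁻¹` in `ℤ/p²ℤ` (where `k` is invertible modulo `p²`).  Then
`S_k(α^p) ≠ 0` in `ℤ/p²ℤ`; that is,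
`α^{3p} − k·α^{2p} − (k+3)·α^p − 1` is a nonzero element of `ℤ/p²ℤ`. -/
theorem shanks_alpha_pow_ne_zero (k : ℤ) (hk : 1 ≤ k) (hk9 : ¬ k ≡ 3 [ZMOD 9])
    (hD : Squarefree (if (3 : ℤ) ∣ k then (k / 3) ^ 2 + k / 3 + 1 else k ^ 2 + 3 * k + 9))
    (p : ℕ) (hp : p.Prime) (hp3 : 3 < p) (hdvd : (p : ℤ) ∣ k ^ 2 + 3 * k + 9) :
    IsUnit (k : ZMod (p ^ 2)) ∧
      (-((k : ZMod (p ^ 2)) + 3) * (k : ZMod (p ^ 2))⁻¹) ^ (3 * p)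
        - (k : ZMod (p ^ 2)) * (-((k : ZMod (p ^ 2)) + 3) * (k : ZMod (p ^ 2))⁻¹) ^ (2 * p)
        - ((k : ZMod (p ^ 2)) + 3) * (-((k : ZMod (p ^ 2)) + 3) * (k : ZMod (p ^ 2))⁻¹) ^ p
        - 1 ≠ 0 := by
  have hpZ : Prime (p : ℤ) := Nat.prime_iff_prime_int.mp hp
  have not_dvd_three : ¬ (p : ℤ) ∣ 3 := fun h => by
    have := Int.le_of_dvd (by norm_num) h
    omega
  have not_dvd_k : ¬ (p : ℤ) ∣ k := fun h => not_dvd_three <| by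
    have h9 : (p : ℤ) ∣ 3 ^ 2 := by
      have := dvd_sub hdvd (h.mul_right (k + 3))
      ring_nf at this ⊢
      exact this
    exact hpZ.dvd_of_dvd_pow h9
  have not_dvd_lin : ¬ (p : ℤ) ∣ 2 * k + 3 := fun h => not_dvd_three <| by
    have h27 : (p : ℤ) ∣ 3 ^ 3 := by
      have := dvd_sub (hdvd.mul_left 4) (h.mul_right (2 * k + 3))
      ring_nf at this ⊢
      exact this
    exact hpZ.dvd_of_dvd_pow h27
  have not_sq_dvd : ¬ (p : ℤ) ^ 2 ∣ k ^ 2 + 3 * k + 9 :=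
    not_sq_dvd_of_squarefree hpZ not_dvd_three hD
  have hunit : IsUnit (k : ZMod (p ^ 2)) := by
    rw [ZMod.coe_int_isUnit_iff_isCoprime]
    push_cast
    exact ((hpZ.coprime_iff_not_dvd).2 not_dvd_k).pow_left
  refine ⟨hunit, ?_⟩
  set a : ZMod (p ^ 2) := -((k : ZMod (p ^ 2)) + 3) * (k : ZMod (p ^ 2))⁻¹ with ha
  have hka : (k : ZMod (p ^ 2)) * a = -(k + 3) := by
    rw [ha, mul_left_comm, ZMod.mul_inv_of_unit _ hunit, mul_one]
  have hcube : (k : ZMod (p ^ 2)) ^ 3 * (a ^ 3 - 1)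
      = -((2 * k + 3) * (k ^ 2 + 3 * k + 9)) := by
    rw [mul_sub, ← mul_pow, hka]
    ring
  have hpow : a ^ (3 * p) = 1 := by
    have hdvd' : (p : ZMod (p ^ 2)) ∣ a ^ 3 - 1 := by
      rw [← (hunit.pow 3).dvd_mul_left, hcube]
      have := map_dvd (Int.castRingHom (ZMod (p ^ 2))) hdvd
      simp only [eq_intCast] at this
      push_cast at this
      exact (this.mul_left _).neg_right
    have h := dvd_sub_pow_of_dvd_sub hdvd' 1
    have h0 : (p : ZMod (p ^ 2)) ^ (1 + 1) = 0 := by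
      exact_mod_cast ZMod.natCast_self (p ^ 2)
    rw [h0, zero_dvd_iff, pow_one, one_pow, ← pow_mul] at h
    exact sub_eq_zero.mp h
  intro hzero
  have hap : IsUnit (a ^ p) :=
    IsUnit.of_pow_eq_one (n := 3) (by rw [← pow_mul, mul_comm, hpow]) (by norm_num)
  have hfix : a ^ p = a := by
    refine (hap.mul hunit).mul_left_cancel ?_
    rw [mul_assoc _ _ a, hka]
    rw [hpow, mul_comm 2 p, pow_mul] at hzero
    linear_combination -hzero
  have ha3 : a ^ 3 = 1 := by
    rw [mul_comm, pow_mul, hfix] at hpow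
    exact hpow
  rw [ha3, sub_self, mul_zero, eq_comm, neg_eq_zero] at hcube
  have hprod : (p : ℤ) ^ 2 ∣ (2 * k + 3) * (k ^ 2 + 3 * k + 9) := by
    have := (ZMod.intCast_zmod_eq_zero_iff_dvd ((2 * k + 3) * (k ^ 2 + 3 * k + 9)) (p ^ 2)).1
      (by push_cast; exact hcube)
    exact_mod_cast this
  exact not_sq_dvd
    (((hpZ.coprime_iff_not_dvd).2 not_dvd_lin).pow_left.dvd_of_dvd_mul_left hprod)
end
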